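/- arXiv:2305.05224 — 2 statements merged into one kernel-verified Lean document; each statement's English description precedes it below -/
import Mathlib

section
/- Let D ≥ 1 and let G be a subgroup of Sp_D(ℝ) that is Zariski-dense in Sp_D(ℝ). Then for every p ∈ {1,…,D}: (1) G is p-contracting, i.e. there exist a sequence (M_n) of elements of G and positive reals (c_n) such that the matrices c_n·(∧ᵖM_n) converge to a matrix of rank 1; and (2) G is L_p-strongly irreducible, i.e. there is no nonempty finite union W = W₁ ∪ … ∪ W_k of linear subspaces of L_p, each satisfying {0} ≠ W_i ≠ L_p, such that (∧ᵖM)(W) = W for every M ∈ G. -/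
open scoped Matrix
open Filter Topology

/-- The standard symplectic form matrix `J = [[0, −I_D],[I_D, 0]]` as a `2D × 2D` matrix. -/
def JmatF (D : ℕ) : Matrix (Fin (2 * D)) (Fin (2 * D)) ℝ :=
  Matrix.of fun i j =>
    if (i : ℕ) + D = (j : ℕ) then -1 else if (j : ℕ) + D = (i : ℕ) then 1 else 0

/-- The symplectic group `Sp_D(ℝ)`, as a set of `2D × 2D` real matrices `M` with
`Mᵀ J M = J`. -/
def SpSetF (D : ℕ) : Set (Matrix (Fin (2 * D)) (Fin (2 * D)) ℝ) :=
  {M | Mᵀ * JmatF D * M = JmatF D}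

/-- The index type of the standard wedge basis of `⋀ᵖ ℝ^N`: `p`-element subsets of `Fin N`. -/
abbrev SubIdx (N p : ℕ) := {s : Finset (Fin N) // s.card = p}

/-- The `p`-th compound matrix of `M`: the matrix of the `p`-th exterior power `∧ᵖM` in the
standard wedge basis `e_{i₁} ∧ … ∧ e_{i_p}`. -/
noncomputable def compound (N p : ℕ) (M : Matrix (Fin N) (Fin N) ℝ) :
    Matrix (SubIdx N p) (SubIdx N p) ℝ :=
  Matrix.of fun s t =>
    Matrix.det (Matrix.of fun i j : Fin p =>
      M ((s.1.orderIsoOfFin s.2 i : Fin N)) ((t.1.orderIsoOfFin t.2 j : Fin N)))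

/-- The subset `{0, 1, …, p−1}` of `Fin N`, indexing the basis vector `e₁ ∧ … ∧ e_p`. -/
def basSubset (N p : ℕ) (h : p ≤ N) : SubIdx N p :=
  ⟨Finset.univ.map (Fin.castLEEmb h), by simp⟩

/-- The subspace `L_p` of `⋀ᵖ ℝ^{2D}` (in wedge-basis coordinates): the span of the vectors
`(∧ᵖM)(e₁ ∧ … ∧ e_p)` for `M ∈ Sp_D(ℝ)`. -/
noncomputable def Lp (D p : ℕ) (h : p ≤ 2 * D) : Submodule ℝ (SubIdx (2 * D) p → ℝ) :=
  Submodule.span ℝ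
    {v | ∃ M ∈ SpSetF D, v = fun s => compound (2 * D) p M s (basSubset (2 * D) p h)}

/-- A set `T` of `2D × 2D` matrices is `p`-contracting: there exist matrices `M_n ∈ T` and
positive reals `c_n` such that `c_n · (∧ᵖM_n)` converges (entrywise) to a rank-one matrix. -/
def PContracting (D p : ℕ) (T : Set (Matrix (Fin (2 * D)) (Fin (2 * D)) ℝ)) : Prop :=
  ∃ (Ms : ℕ → Matrix (Fin (2 * D)) (Fin (2 * D)) ℝ) (c : ℕ → ℝ)
    (A : Matrix (SubIdx (2 * D) p) (SubIdx (2 * D) p) ℝ),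
    (∀ n, Ms n ∈ T) ∧ (∀ n, 0 < c n) ∧ A.rank = 1 ∧
    ∀ s t, Tendsto (fun n => c n * compound (2 * D) p (Ms n) s t) atTop (𝓝 (A s t))

/-- A set `T` of `2D × 2D` matrices is `L_p`-strongly irreducible: there is no nonempty finite
union of proper nonzero subspaces of `L_p` invariant under `∧ᵖM` for every `M ∈ T`. -/
def LpStronglyIrreducible (D p : ℕ) (h : p ≤ 2 * D)
    (T : Set (Matrix (Fin (2 * D)) (Fin (2 * D)) ℝ)) : Prop :=
  ¬ ∃ (k : ℕ) (W : Fin (k + 1) → Submodule ℝ (SubIdx (2 * D) p → ℝ)),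
      (∀ i, W i ≤ Lp D p h ∧ W i ≠ ⊥ ∧ W i ≠ Lp D p h) ∧
      ∀ M ∈ T,
        (fun v => (compound (2 * D) p M).mulVec v) ''
            (⋃ i, (W i : Set (SubIdx (2 * D) p → ℝ)))
          = ⋃ i, (W i : Set (SubIdx (2 * D) p → ℝ))

namespace GM

def idxEquiv (N p : ℕ) : Set.powersetCard (Fin N) p ≃ SubIdx N p where
  toFun s := ⟨s.1, s.2⟩
  invFun s := ⟨s.1, s.2⟩
  left_inv _ := rfl
  right_inv _ := rfl

noncomputable def wedgeBasis (N p : ℕ) :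
    Module.Basis (SubIdx N p) ℝ (⋀[ℝ]^p (Fin N → ℝ)) :=
  ((Pi.basisFun ℝ (Fin N)).exteriorPower p).reindex (idxEquiv N p)

lemma compound_eq_toMatrix (N p : ℕ) (M : Matrix (Fin N) (Fin N) ℝ) :
    compound N p M = LinearMap.toMatrix (wedgeBasis N p) (wedgeBasis N p)
      (exteriorPower.map p (Matrix.toLin' M)) := by
  ext s t
  rw [LinearMap.toMatrix_apply, wedgeBasis, Module.Basis.repr_reindex_apply,
    Module.Basis.reindex_apply, exteriorPower.basis_repr_apply, exteriorPower.basis_apply,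
    exteriorPower.map_apply_ιMulti_family]
  rw [exteriorPower.ιMulti_family, exteriorPower.ιMultiDual_apply_ιMulti]
  rw [← Matrix.det_transpose]
  simp only [compound, Matrix.of_apply]
  congr 1
  ext i j
  simp [Matrix.transpose_apply, Set.powersetCard.ofFinEmbEquiv_symm_apply]
  rfl

lemma compound_mul (N p : ℕ) (A B : Matrix (Fin N) (Fin N) ℝ) :
    compound N p (A * B) = compound N p A * compound N p B := by
  rw [compound_eq_toMatrix, compound_eq_toMatrix, compound_eq_toMatrix, Matrix.toLin'_mul,
    exteriorPower.map_comp]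
  exact LinearMap.toMatrix_comp _ (wedgeBasis N p) _ _ _

lemma compound_transpose (N p : ℕ) (A : Matrix (Fin N) (Fin N) ℝ) :
    compound N p Aᵀ = (compound N p A)ᵀ := by
  ext s t
  rw [Matrix.transpose_apply]
  simp only [compound, Matrix.of_apply]
  rw [← Matrix.det_transpose]
  rfl

lemma compound_smul (N p : ℕ) (c : ℝ) (A : Matrix (Fin N) (Fin N) ℝ) :
    compound N p (c • A) = c ^ p • compound N p A := by
  ext s t
  rw [Matrix.smul_apply]
  simp only [compound, Matrix.of_apply, Matrix.smul_apply]
  have := Matrix.det_smul (Matrix.of fun i j : Fin p => A ((s.1.orderIsoOfFin s.2 i : Fin N)) ((t.1.orderIsoOfFin t.2 j : Fin N))) c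
  rw [Fintype.card_fin] at this
  rw [smul_eq_mul, ← this]
  congr 1

/-- If the columns of `M` indexed by `t` are the basis vectors indexed by `u`, in order. -/
lemma compound_col {N p : ℕ} (M : Matrix (Fin N) (Fin N) ℝ) (t u : SubIdx N p) (d : Fin p → ℝ)
    (h : ∀ (x : Fin N) (j : Fin p), M x (t.1.orderIsoOfFin t.2 j : Fin N) =
      if x = (u.1.orderIsoOfFin u.2 j : Fin N) then d j else 0) (s : SubIdx N p) :
    compound N p M s t = if s = u then ∏ j, d j else 0 := by
  split_ifs with hs
  · subst hs
    have : (Matrix.of fun i j : Fin p => M ((s.1.orderIsoOfFin s.2 i : Fin N))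
        ((t.1.orderIsoOfFin t.2 j : Fin N))) = Matrix.diagonal d := by
      ext i j
      simp only [Matrix.of_apply, h, Matrix.diagonal_apply]
      by_cases hij : i = j
      · simp [hij]
      · have : ¬ ((s.1.orderIsoOfFin s.2 i : Fin N)) = ((s.1.orderIsoOfFin s.2 j : Fin N)) := by
          intro hh
          exact hij ((s.1.orderIsoOfFin s.2).injective (Subtype.ext hh))
        simp [hij, this]
    simp only [compound, Matrix.of_apply]
    rw [this, Matrix.det_diagonal]
  · have : ∃ x ∈ u.1, x ∉ s.1 := by
      by_contra hcon
      push Not at hcon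
      apply hs
      apply Subtype.ext
      exact (Finset.eq_of_subset_of_card_le hcon (by rw [s.2, u.2])).symm
    obtain ⟨x, hxu, hxs⟩ := this
    obtain ⟨j, hj⟩ := (u.1.orderIsoOfFin u.2).surjective ⟨x, hxu⟩
    simp only [compound, Matrix.of_apply]
    apply Matrix.det_eq_zero_of_column_eq_zero j
    intro i
    rw [Matrix.of_apply, h, if_neg]
    intro hh
    apply hxs
    rw [hj] at hh
    rw [← show ((s.1.orderIsoOfFin s.2 i : Fin N)) = x from hh]
    exact (s.1.orderIsoOfFin s.2 i).2

lemma compound_diagonal (N p : ℕ) (d : Fin N → ℝ) :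
    compound N p (Matrix.diagonal d) = Matrix.diagonal fun s : SubIdx N p => ∏ i ∈ s.1, d i := by
  ext s t
  rw [compound_col _ t t (fun j => d (t.1.orderIsoOfFin t.2 j : Fin N))]
  · rw [Matrix.diagonal_apply]
    split_ifs with h
    · subst h
      rw [← Finset.prod_coe_sort s.1]
      exact Fintype.prod_equiv (s.1.orderIsoOfFin s.2).toEquiv _ _ (fun _ => rfl)
    · rfl
  · intro x j
    rw [Matrix.diagonal_apply]
    split_ifs with h
    · rw [h]
    · rfl

lemma compound_one (N p : ℕ) : compound N p 1 = 1 := by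
  rw [← Matrix.diagonal_one, compound_diagonal]
  simp

lemma continuous_compound (N p : ℕ) : Continuous (compound N p) := by
  refine continuous_matrix fun s t => ?_
  simp only [compound, Matrix.of_apply]
  apply Continuous.matrix_det
  refine continuous_matrix fun i j => ?_
  simp only [Matrix.of_apply]
  exact continuous_id.matrix_elem _ _

lemma basSubset_val (N p : ℕ) (h : p ≤ N) (j : Fin p) :
    (((basSubset N p h).1.orderIsoOfFin (basSubset N p h).2 j : Fin N) : ℕ) = j := by
  have : (fun j : Fin p => ((basSubset N p h).1.orderIsoOfFin (basSubset N p h).2 j : Fin N)) =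
      Fin.castLE h := by
    have := Finset.orderEmbOfFin_unique (basSubset N p h).2 (f := Fin.castLE h)
      (by intro x; simp [basSubset]) (Fin.strictMono_castLE h)
    rw [this]
    rfl
  have h2 := congrFun this j
  rw [h2]
  rfl

lemma mem_basSubset (N p : ℕ) (h : p ≤ N) (x : Fin N) : x ∈ (basSubset N p h).1 ↔ (x : ℕ) < p := by
  simp only [basSubset, Finset.mem_map, Finset.mem_univ, true_and]
  constructor
  · rintro ⟨a, rfl⟩
    simp
  · intro hx
    exact ⟨⟨x, hx⟩, by ext; simp⟩

end GM

namespace GM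

/-- The identification of `Fin D ⊕ Fin D` with `Fin (2 * D)`. -/
def eqv (D : ℕ) : Fin D ⊕ Fin D ≃ Fin (2 * D) :=
  finSumFinEquiv.trans (finCongr (two_mul D).symm)

lemma eqv_inl (D : ℕ) (i : Fin D) : ((eqv D (Sum.inl i) : Fin (2 * D)) : ℕ) = i := by
  simp [eqv]

lemma eqv_inr (D : ℕ) (i : Fin D) : ((eqv D (Sum.inr i) : Fin (2 * D)) : ℕ) = D + i := by
  simp [eqv, add_comm]

lemma JmatF_eq (D : ℕ) : (JmatF D).submatrix (eqv D) (eqv D) = Matrix.J (Fin D) ℝ := by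
  ext i j
  rcases i with i | i <;> rcases j with j | j <;>
    simp only [Matrix.submatrix_apply, JmatF, Matrix.of_apply, eqv_inl, eqv_inr, Matrix.J,
      Matrix.fromBlocks_apply₁₁, Matrix.fromBlocks_apply₁₂, Matrix.fromBlocks_apply₂₁,
      Matrix.fromBlocks_apply₂₂, Matrix.zero_apply, Matrix.neg_apply, Matrix.one_apply]
  · have := i.2
    have := j.2
    rw [if_neg (by omega), if_neg (by omega)]
  · have := i.2
    have := j.2
    by_cases h : i = j
    · subst h; rw [if_pos (by omega)]; simp
    · have h' : (i : ℕ) ≠ j := fun hh => h (Fin.ext hh)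
      rw [if_neg (by omega), if_neg (by omega)]; simp [h]
  · have := i.2
    have := j.2
    by_cases h : i = j
    · subst h; rw [if_neg (by omega), if_pos (by omega)]; simp
    · have h' : (i : ℕ) ≠ j := fun hh => h (Fin.ext hh)
      rw [if_neg (by omega), if_neg (by omega)]; simp [h]
  · have := i.2
    have := j.2
    rw [if_neg (by omega), if_neg (by omega)]

/-- reindexing of matrices -/
def toF {D : ℕ} (M : Matrix (Fin D ⊕ Fin D) (Fin D ⊕ Fin D) ℝ) :
    Matrix (Fin (2 * D)) (Fin (2 * D)) ℝ := M.submatrix (eqv D).symm (eqv D).symm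

lemma mem_Sp_iff {D : ℕ} (M : Matrix (Fin (2 * D)) (Fin (2 * D)) ℝ) :
    M ∈ SpSetF D ↔ M.submatrix (eqv D) (eqv D) ∈ Matrix.symplecticGroup (Fin D) ℝ := by
  rw [SymplecticGroup.mem_iff', ← JmatF_eq, Matrix.transpose_submatrix,
    Matrix.submatrix_mul_equiv, Matrix.submatrix_mul_equiv]
  constructor
  · intro h
    rw [show Mᵀ * JmatF D * M = JmatF D from h]
  · intro h
    have := congrArg (fun X => Matrix.submatrix X (eqv D).symm (eqv D).symm) h
    have h2 : Mᵀ * JmatF D * M = JmatF D := by simpa using this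
    exact h2

lemma toF_mem {D : ℕ} {M : Matrix (Fin D ⊕ Fin D) (Fin D ⊕ Fin D) ℝ} :
    toF M ∈ SpSetF D ↔ M ∈ Matrix.symplecticGroup (Fin D) ℝ := by
  rw [mem_Sp_iff]
  simp [toF]

lemma exists_toF {D : ℕ} (M : Matrix (Fin (2 * D)) (Fin (2 * D)) ℝ) : ∃ N, M = toF N := 
  ⟨M.submatrix (eqv D) (eqv D), by simp [toF]⟩

lemma Sp_one (D : ℕ) : (1 : Matrix (Fin (2 * D)) (Fin (2 * D)) ℝ) ∈ SpSetF D := by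
  simp [SpSetF]

lemma Sp_mul {D : ℕ} {A B : Matrix (Fin (2 * D)) (Fin (2 * D)) ℝ} (hA : A ∈ SpSetF D)
    (hB : B ∈ SpSetF D) : A * B ∈ SpSetF D := by
  have hA' : Aᵀ * JmatF D * A = JmatF D := hA
  have hB' : Bᵀ * JmatF D * B = JmatF D := hB
  show (A * B)ᵀ * JmatF D * (A * B) = JmatF D
  rw [Matrix.transpose_mul]
  calc Bᵀ * Aᵀ * JmatF D * (A * B) = Bᵀ * (Aᵀ * JmatF D * A) * B := by
        simp only [Matrix.mul_assoc]
    _ = _ := by rw [hA', hB']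

lemma Sp_transpose {D : ℕ} {A : Matrix (Fin (2 * D)) (Fin (2 * D)) ℝ} (hA : A ∈ SpSetF D) :
    Aᵀ ∈ SpSetF D := by
  rw [mem_Sp_iff] at *
  rw [← Matrix.transpose_submatrix]
  exact SymplecticGroup.transpose_mem hA

/-- polynomial functions of matrices -/
def IsPoly {N : ℕ} (f : Matrix (Fin N) (Fin N) ℝ → ℝ) : Prop :=
  ∃ P : MvPolynomial (Fin N × Fin N) ℝ, ∀ M, MvPolynomial.eval (fun q => M q.1 q.2) P = f M

namespace IsPoly
variable {N : ℕ} {f g : Matrix (Fin N) (Fin N) ℝ → ℝ}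

lemma const (c : ℝ) : IsPoly (N := N) (fun _ => c) := ⟨MvPolynomial.C c, fun M => by simp⟩

lemma coord (i j : Fin N) : IsPoly (N := N) (fun M => M i j) :=
  ⟨MvPolynomial.X (i, j), fun M => by simp⟩

lemma add (hf : IsPoly f) (hg : IsPoly g) : IsPoly (fun M => f M + g M) := by
  obtain ⟨P, hP⟩ := hf
  obtain ⟨Q, hQ⟩ := hg
  exact ⟨P + Q, fun M => by simp [hP, hQ]⟩

lemma mul (hf : IsPoly f) (hg : IsPoly g) : IsPoly (fun M => f M * g M) := by
  obtain ⟨P, hP⟩ := hf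
  obtain ⟨Q, hQ⟩ := hg
  exact ⟨P * Q, fun M => by simp [hP, hQ]⟩

lemma sub (hf : IsPoly f) (hg : IsPoly g) : IsPoly (fun M => f M - g M) := by
  obtain ⟨P, hP⟩ := hf
  obtain ⟨Q, hQ⟩ := hg
  exact ⟨P - Q, fun M => by simp [hP, hQ]⟩

lemma sum {ι : Type*} (s : Finset ι) {f : ι → Matrix (Fin N) (Fin N) ℝ → ℝ}
    (h : ∀ i ∈ s, IsPoly (f i)) : IsPoly (fun M => ∑ i ∈ s, f i M) := by
  classical
  induction s using Finset.induction_on with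
  | empty => simpa using const 0
  | insert a s ha ih =>
    simp only [Finset.sum_insert ha]
    exact (h a (by simp)).add (ih fun i hi => h i (by simp [hi]))

lemma prod {ι : Type*} (s : Finset ι) {f : ι → Matrix (Fin N) (Fin N) ℝ → ℝ}
    (h : ∀ i ∈ s, IsPoly (f i)) : IsPoly (fun M => ∏ i ∈ s, f i M) := by
  classical
  induction s using Finset.induction_on with
  | empty => simpa using const 1
  | insert a s ha ih =>
    simp only [Finset.prod_insert ha]
    exact (h a (by simp)).mul (ih fun i hi => h i (by simp [hi]))

lemma compound (p : ℕ) (s t : SubIdx N p) : IsPoly (fun M => compound N p M s t) := by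
  simp only [_root_.compound, Matrix.of_apply, Matrix.det_apply', Matrix.of_apply]
  exact sum _ fun σ _ => (const _).mul (prod _ fun i _ => coord _ _)

/-- linear forms in the compound -/
lemma lin (p : ℕ) {m : Type*} [Fintype m] {n : Type*} [Fintype n] (B : Matrix m (SubIdx N p) ℝ)
    (A : Matrix (SubIdx N p) n ℝ) (i : m) (j : n) :
    IsPoly (fun M => (B * _root_.compound N p M * A) i j) := by
  simp only [Matrix.mul_apply]
  exact sum _ fun _ _ => (sum _ fun _ _ => (const _).mul (compound p _ _)).mul (const _)

lemma path (hf : IsPoly f) (Q : Matrix (Fin N) (Fin N) (Polynomial ℝ)) :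
    ∃ F : Polynomial ℝ, ∀ t : ℝ, F.eval t = f (Q.map (Polynomial.evalRingHom t)) := by
  obtain ⟨P, hP⟩ := hf
  refine ⟨MvPolynomial.aeval (fun q : Fin N × Fin N => Q q.1 q.2) P, fun t => ?_⟩
  rw [← hP, ← Polynomial.coe_evalRingHom, MvPolynomial.aeval_def, MvPolynomial.hom_eval₂]
  have : (Polynomial.evalRingHom t).comp (algebraMap ℝ (Polynomial ℝ)) = RingHom.id ℝ := by
    ext; simp
  rw [this]
  rfl

end IsPoly

end GM

namespace GM

lemma exists_eval_ne {F : Polynomial ℝ} (h : F ≠ 0) : ∃ t, F.eval t ≠ 0 := by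
  by_contra hcon
  push Not at hcon
  exact h (Polynomial.funext fun t => by simpa using hcon t)

lemma ne_zero_of_eval {F : Polynomial ℝ} {t : ℝ} (h : F.eval t ≠ 0) : F ≠ 0 := by
  rintro rfl
  simp at h

lemma toF_map {D : ℕ} (Q : Matrix (Fin D ⊕ Fin D) (Fin D ⊕ Fin D) (Polynomial ℝ)) (t : ℝ) :
    (Q.submatrix (eqv D).symm (eqv D).symm).map (Polynomial.evalRingHom t) =
      toF (Q.map (Polynomial.evalRingHom t)) := rfl

/-- `det (A + t C)` is not the zero polynomial, for the first block column of a symplectic matrix -/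
lemma det_pencil_ne {D : ℕ} {A B C E : Matrix (Fin D) (Fin D) ℝ}
    (h : Matrix.fromBlocks A B C E ∈ Matrix.symplecticGroup (Fin D) ℝ) :
    (A.map Polynomial.C + (Polynomial.X : Polynomial ℝ) • C.map Polynomial.C).det ≠ 0 := by
  intro h0
  have h1 := congrArg (Polynomial.eval₂RingHom (algebraMap ℝ ℂ) Complex.I) h0
  rw [map_zero, RingHom.map_det] at h1
  obtain ⟨x, hx0, hx⟩ := Matrix.exists_mulVec_eq_zero_iff.2 h1
  have hmat : (Polynomial.eval₂RingHom (algebraMap ℝ ℂ) Complex.I).mapMatrix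
      (A.map Polynomial.C + (Polynomial.X : Polynomial ℝ) • C.map Polynomial.C) =
      A.map (algebraMap ℝ ℂ) + Complex.I • C.map (algebraMap ℝ ℂ) := by
    ext i j
    simp
    ring
  rw [hmat] at hx
  set u : Fin D → ℝ := fun i => (x i).re
  set v : Fin D → ℝ := fun i => (x i).im
  have hr : ∀ i, (A *ᵥ u) i = (C *ᵥ v) i ∧ (A *ᵥ v) i = - (C *ᵥ u) i := by
    intro i
    have hi := congrFun hx i
    have h1 := congrArg Complex.re hi
    have h2 := congrArg Complex.im hi
    simp only [Matrix.mulVec, dotProduct, Matrix.add_apply, Matrix.smul_apply, Matrix.map_apply,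
      Complex.re_sum, Complex.im_sum, Pi.zero_apply, Complex.zero_re, Complex.zero_im] at h1 h2
    simp at h1 h2
    constructor
    · rw [← sub_eq_zero, ← h1]
      simp only [Matrix.mulVec, dotProduct, u, v]
    · rw [← sub_eq_zero, ← h2]
      simp only [Matrix.mulVec, dotProduct, u, v]
      rw [sub_neg_eq_add, ← Finset.sum_add_distrib]
  have e1 : A *ᵥ u = C *ᵥ v := funext fun i => (hr i).1
  have e2 : A *ᵥ v = - (C *ᵥ u) := funext fun i => (hr i).2
  have hs := (SymplecticGroup.fromBlocks_mem_iff.1 h).1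
  have key : ∀ a b : Fin D → ℝ, (A *ᵥ a) ⬝ᵥ (C *ᵥ b) = (C *ᵥ a) ⬝ᵥ (A *ᵥ b) := by
    intro a b
    have : a ⬝ᵥ (Aᵀ * C) *ᵥ b = a ⬝ᵥ (Cᵀ * A) *ᵥ b := by rw [hs]
    rw [← Matrix.mulVec_mulVec, ← Matrix.mulVec_mulVec, Matrix.dotProduct_mulVec a,
      Matrix.dotProduct_mulVec a, Matrix.vecMul_transpose, Matrix.vecMul_transpose] at this
    exact this
  have kill : ∀ a : Fin D → ℝ, (A *ᵥ a) ⬝ᵥ (A *ᵥ a) = - ((C *ᵥ a) ⬝ᵥ (C *ᵥ a)) → a = 0 := by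
    intro a ha
    have p1 : 0 ≤ (A *ᵥ a) ⬝ᵥ (A *ᵥ a) := by
      simpa using dotProduct_self_star_nonneg (A *ᵥ a)
    have p2 : 0 ≤ (C *ᵥ a) ⬝ᵥ (C *ᵥ a) := by
      simpa using dotProduct_self_star_nonneg (C *ᵥ a)
    have z1 : A *ᵥ a = 0 := dotProduct_self_eq_zero.1 (by linarith)
    have z2 : C *ᵥ a = 0 := dotProduct_self_eq_zero.1 (by linarith)
    have hU : IsUnit (Matrix.fromBlocks A B C E) := by
      rw [Matrix.isUnit_iff_isUnit_det]
      exact SymplecticGroup.symplectic_det h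
    have hv0 : (Matrix.fromBlocks A B C E) *ᵥ (Sum.elim a 0) =
        (Matrix.fromBlocks A B C E) *ᵥ (Sum.elim 0 0) := by
      simp [Matrix.fromBlocks_mulVec, z1, z2]
    exact (Sum.elim_eq_iff.1 (Matrix.mulVec_injective_iff_isUnit.2 hU hv0)).1
  have hu : u = 0 := by
    apply kill
    nth_rw 2 [e1]
    rw [key, e2]
    simp
  have hv : v = 0 := by
    apply kill
    nth_rw 1 [e2]
    rw [neg_dotProduct, ← key, e1]
  apply hx0
  funext i
  exact Complex.ext (congrFun hu i) (congrFun hv i)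

lemma upper_mem {D : ℕ} {X : Matrix (Fin D) (Fin D) ℝ} (hX : Xᵀ = X) :
    Matrix.fromBlocks 1 X 0 1 ∈ Matrix.symplecticGroup (Fin D) ℝ := by
  rw [SymplecticGroup.fromBlocks_mem_iff]
  simp [hX]

lemma lower_mem {D : ℕ} {X : Matrix (Fin D) (Fin D) ℝ} (hX : Xᵀ = X) :
    Matrix.fromBlocks 1 0 X 1 ∈ Matrix.symplecticGroup (Fin D) ℝ := by
  rw [SymplecticGroup.fromBlocks_mem_iff]
  simp [hX]

lemma diag_mem {D : ℕ} {A E : Matrix (Fin D) (Fin D) ℝ} (h : Aᵀ * E = 1) :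
    Matrix.fromBlocks A 0 0 E ∈ Matrix.symplecticGroup (Fin D) ℝ := by
  rw [SymplecticGroup.fromBlocks_mem_iff]
  simp [h]

/-- Big cell parametrization. -/
lemma cell_mem {D : ℕ} {A B C : Matrix (Fin D) (Fin D) ℝ} (hA : A.det ≠ 0) (hB : Bᵀ = B)
    (hC : Cᵀ = C) :
    Matrix.fromBlocks A (A * B) (C * A) (C * A * B + (A⁻¹)ᵀ) ∈
      Matrix.symplecticGroup (Fin D) ℝ := by
  have h1 : Aᵀ * (A⁻¹)ᵀ = 1 := by
    rw [← Matrix.transpose_mul, Matrix.nonsing_inv_mul _ (isUnit_iff_ne_zero.2 hA),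
      Matrix.transpose_one]
  have := mul_mem (mul_mem (lower_mem hC) (diag_mem h1)) (upper_mem hB)
  simpa [Matrix.fromBlocks_multiply] using this

lemma cell_exists {D : ℕ} {A B C E : Matrix (Fin D) (Fin D) ℝ}
    (h : Matrix.fromBlocks A B C E ∈ Matrix.symplecticGroup (Fin D) ℝ) (hA : A.det ≠ 0) :
    ∃ B' C' : Matrix (Fin D) (Fin D) ℝ, B'ᵀ = B' ∧ C'ᵀ = C' ∧
      Matrix.fromBlocks A B C E =
        Matrix.fromBlocks A (A * B') (C' * A) (C' * A * B' + (A⁻¹)ᵀ) := by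
  have hAu := isUnit_iff_ne_zero.2 hA
  have hl := Matrix.nonsing_inv_mul A hAu
  have hr := Matrix.mul_nonsing_inv A hAu
  have hlt : (A⁻¹)ᵀ * Aᵀ = 1 := by rw [← Matrix.transpose_mul, hr, Matrix.transpose_one]
  have hrt : Aᵀ * (A⁻¹)ᵀ = 1 := by rw [← Matrix.transpose_mul, hl, Matrix.transpose_one]
  have h1 := SymplecticGroup.fromBlocks_mem_iff.1 h
  have h2 := SymplecticGroup.transpose_mem h
  rw [Matrix.fromBlocks_transpose] at h2
  have h3 := SymplecticGroup.fromBlocks_mem_iff.1 h2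
  simp only [Matrix.transpose_transpose] at h3
  have hC : (C * A⁻¹)ᵀ = C * A⁻¹ := by
    rw [Matrix.transpose_mul]
    calc (A⁻¹)ᵀ * Cᵀ = (A⁻¹)ᵀ * (Cᵀ * A) * A⁻¹ := by
          rw [Matrix.mul_assoc, Matrix.mul_assoc, hr, Matrix.mul_one]
      _ = (A⁻¹)ᵀ * Aᵀ * C * A⁻¹ := by rw [← h1.1]; simp only [Matrix.mul_assoc]
      _ = _ := by rw [hlt, Matrix.one_mul]
  have hB : (A⁻¹ * B)ᵀ = A⁻¹ * B := by
    rw [Matrix.transpose_mul]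
    calc Bᵀ * (A⁻¹)ᵀ = A⁻¹ * (A * Bᵀ) * (A⁻¹)ᵀ := by
          rw [← Matrix.mul_assoc, hl, Matrix.one_mul]
      _ = A⁻¹ * B * (Aᵀ * (A⁻¹)ᵀ) := by rw [h3.1]; simp only [Matrix.mul_assoc]
      _ = _ := by rw [hrt, Matrix.mul_one]
  refine ⟨A⁻¹ * B, C * A⁻¹, hB, hC, ?_⟩
  have e1 : A * (A⁻¹ * B) = B := by rw [← Matrix.mul_assoc, hr, Matrix.one_mul]
  have e2 : C * A⁻¹ * A = C := by rw [Matrix.mul_assoc, hl, Matrix.mul_one]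
  rw [e1, e2]
  congr 1
  calc E = (A⁻¹)ᵀ * (Aᵀ * E) := by rw [← Matrix.mul_assoc, hlt, Matrix.one_mul]
    _ = (A⁻¹)ᵀ * (1 + Cᵀ * B) := by rw [← h1.2.2]; simp
    _ = (C * A⁻¹)ᵀ * B + (A⁻¹)ᵀ := by
        rw [Matrix.mul_add, Matrix.mul_one, Matrix.transpose_mul, Matrix.mul_assoc, add_comm]
    _ = _ := by rw [hC, Matrix.mul_assoc]

/-- Move into the big cell. -/
lemma to_cell {D : ℕ} {f : Matrix (Fin (2 * D)) (Fin (2 * D)) ℝ → ℝ} (hf : IsPoly f)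
    {M : Matrix (Fin (2 * D)) (Fin (2 * D)) ℝ} (hM : M ∈ SpSetF D) (h : f M ≠ 0) :
    ∃ A B C : Matrix (Fin D) (Fin D) ℝ, A.det ≠ 0 ∧ Bᵀ = B ∧ Cᵀ = C ∧
      f (toF (Matrix.fromBlocks A (A * B) (C * A) (C * A * B + (A⁻¹)ᵀ))) ≠ 0 := by
  obtain ⟨N, rfl⟩ := exists_toF M
  obtain ⟨A, B, C, E, rfl⟩ : ∃ A B C E, N = Matrix.fromBlocks A B C E :=
    ⟨_, _, _, _, (Matrix.fromBlocks_toBlocks N).symm⟩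
  rw [toF_mem] at hM
  let c : Matrix (Fin D) (Fin D) ℝ → Matrix (Fin D) (Fin D) (Polynomial ℝ) :=
    fun M => M.map Polynomial.C
  let Q : Matrix (Fin D ⊕ Fin D) (Fin D ⊕ Fin D) (Polynomial ℝ) :=
    Matrix.fromBlocks (c A + (Polynomial.X : Polynomial ℝ) • c C)
      (c B + (Polynomial.X : Polynomial ℝ) • c E) (c C) (c E)
  have hQ : ∀ t : ℝ, Q.map (Polynomial.evalRingHom t) =
      Matrix.fromBlocks (A + t • C) (B + t • E) C E := by
    intro t
    simp only [Q, Matrix.fromBlocks_map]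
    congr 1 <;> ext i j <;> simp [c] <;> ring
  obtain ⟨F, hF⟩ := hf.path (Q.submatrix (eqv D).symm (eqv D).symm)
  have hF0 : F ≠ 0 := by
    apply ne_zero_of_eval (t := 0)
    rw [hF, toF_map, hQ]
    simpa using h
  obtain ⟨t, ht⟩ := exists_eval_ne (mul_ne_zero hF0 (det_pencil_ne hM))
  rw [Polynomial.eval_mul, mul_ne_zero_iff, hF, toF_map, hQ] at ht
  have hdet : (A + t • C).det ≠ 0 := by
    have := ht.2
    rw [← Polynomial.coe_evalRingHom, RingHom.map_det] at this
    convert this using 2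
    ext i j
    simp
    ring
  have hmem : Matrix.fromBlocks (A + t • C) (B + t • E) C E ∈
      Matrix.symplecticGroup (Fin D) ℝ := by
    have := mul_mem (upper_mem (X := t • (1 : Matrix (Fin D) (Fin D) ℝ)) (by simp)) hM
    simpa [Matrix.fromBlocks_multiply] using this
  obtain ⟨B', C', hB, hC, heq⟩ := cell_exists hmem hdet
  exact ⟨A + t • C, B', C', hdet, hB, hC, by rw [← heq]; exact ht.1⟩

/-- Irreducibility of the symplectic group, for homogeneous polynomials. -/
lemma irr_two {D : ℕ} {f g : Matrix (Fin (2 * D)) (Fin (2 * D)) ℝ → ℝ} (hf : IsPoly f)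
    (hg : IsPoly g) {a b : ℕ} (hfa : ∀ (c : ℝ) M, f (c • M) = c ^ a * f M)
    (hgb : ∀ (c : ℝ) M, g (c • M) = c ^ b * g M) {M₁ M₂ : Matrix (Fin (2 * D)) (Fin (2 * D)) ℝ}
    (h1 : M₁ ∈ SpSetF D) (h2 : M₂ ∈ SpSetF D) (hf1 : f M₁ ≠ 0) (hg2 : g M₂ ≠ 0) :
    ∃ M ∈ SpSetF D, f M ≠ 0 ∧ g M ≠ 0 := by
  obtain ⟨A₁, B₁, C₁, hA₁, hB₁, hC₁, hfc⟩ := to_cell hf h1 hf1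
  obtain ⟨A₂, B₂, C₂, hA₂, hB₂, hC₂, hgc⟩ := to_cell hg h2 hg2
  let c : Matrix (Fin D) (Fin D) ℝ → Matrix (Fin D) (Fin D) (Polynomial ℝ) :=
    fun M => M.map Polynomial.C
  let A := c A₁ + (Polynomial.X : Polynomial ℝ) • c (A₂ - A₁)
  let B := c B₁ + (Polynomial.X : Polynomial ℝ) • c (B₂ - B₁)
  let C := c C₁ + (Polynomial.X : Polynomial ℝ) • c (C₂ - C₁)
  let a' : ℝ → Matrix (Fin D) (Fin D) ℝ := fun t => A₁ + t • (A₂ - A₁)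
  let b' : ℝ → Matrix (Fin D) (Fin D) ℝ := fun t => B₁ + t • (B₂ - B₁)
  let c' : ℝ → Matrix (Fin D) (Fin D) ℝ := fun t => C₁ + t • (C₂ - C₁)
  have hA : ∀ t, (Polynomial.evalRingHom t).mapMatrix A = a' t := by
    intro t; ext i j; simp [A, c, a']
  have hB : ∀ t, (Polynomial.evalRingHom t).mapMatrix B = b' t := by
    intro t; ext i j; simp [B, c, b']
  have hC : ∀ t, (Polynomial.evalRingHom t).mapMatrix C = c' t := by
    intro t; ext i j; simp [C, c, c']
  have hdetA : ∀ t, Polynomial.eval t A.det = (a' t).det := by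
    intro t
    rw [← Polynomial.coe_evalRingHom, RingHom.map_det, hA]
  clear_value A B C
  let Q : Matrix (Fin D ⊕ Fin D) (Fin D ⊕ Fin D) (Polynomial ℝ) :=
    Matrix.fromBlocks (A.det • A) (A.det • (A * B)) (A.det • (C * A))
      (A.det • (C * A * B) + A.adjugateᵀ)
  let cell : ℝ → Matrix (Fin D ⊕ Fin D) (Fin D ⊕ Fin D) ℝ := fun t =>
    Matrix.fromBlocks (a' t) (a' t * b' t) (c' t * a' t) (c' t * a' t * b' t + ((a' t)⁻¹)ᵀ)
  have hsm : ∀ (t : ℝ) (q : Polynomial ℝ) (X : Matrix (Fin D) (Fin D) (Polynomial ℝ)),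
      (Polynomial.evalRingHom t).mapMatrix (q • X) =
        q.eval t • (Polynomial.evalRingHom t).mapMatrix X := by
    intro t q X; ext i j; simp
  have htr : ∀ (t : ℝ) (X : Matrix (Fin D) (Fin D) (Polynomial ℝ)),
      (Polynomial.evalRingHom t).mapMatrix Xᵀ =
        ((Polynomial.evalRingHom t).mapMatrix X)ᵀ := by
    intro t X; ext i j; simp
  have hQ : ∀ t : ℝ, (a' t).det ≠ 0 → Q.map (Polynomial.evalRingHom t) =
      (a' t).det • cell t := by
    intro t ht
    have hadj : (a' t).adjugate = (a' t).det • (a' t)⁻¹ := by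
      rw [Matrix.inv_def, Ring.inverse_eq_inv', smul_smul, mul_inv_cancel₀ ht, one_smul]
    simp only [Q, Matrix.fromBlocks_map, cell, Matrix.fromBlocks_smul]
    simp only [← RingHom.mapMatrix_apply]
    simp only [hsm, map_add, htr, RingHom.map_adjugate, map_mul, hA, hB, hC, hdetA, hadj, smul_add,
      Matrix.transpose_smul]
  obtain ⟨F, hF⟩ := hf.path (Q.submatrix (eqv D).symm (eqv D).symm)
  obtain ⟨G, hG⟩ := hg.path (Q.submatrix (eqv D).symm (eqv D).symm)
  have hF' : ∀ t, (a' t).det ≠ 0 → F.eval t = (a' t).det ^ a * f (toF (cell t)) := by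
    intro t ht
    rw [hF, toF_map, hQ t ht, ← hfa]
    rfl
  have hG' : ∀ t, (a' t).det ≠ 0 → G.eval t = (a' t).det ^ b * g (toF (cell t)) := by
    intro t ht
    rw [hG, toF_map, hQ t ht, ← hgb]
    rfl
  have e0 : a' 0 = A₁ := by simp [a']
  have e1 : a' 1 = A₂ := by simp [a']
  have c0 : cell 0 = Matrix.fromBlocks A₁ (A₁ * B₁) (C₁ * A₁) (C₁ * A₁ * B₁ + (A₁⁻¹)ᵀ) := by
    simp [cell, a', b', c']
  have c1 : cell 1 = Matrix.fromBlocks A₂ (A₂ * B₂) (C₂ * A₂) (C₂ * A₂ * B₂ + (A₂⁻¹)ᵀ) := by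
    simp [cell, a', b', c']
  have nF : F ≠ 0 := by
    apply ne_zero_of_eval (t := 0)
    rw [hF' 0 (by rwa [e0]), e0, c0]
    exact mul_ne_zero (pow_ne_zero _ hA₁) hfc
  have nG : G ≠ 0 := by
    apply ne_zero_of_eval (t := 1)
    rw [hG' 1 (by rwa [e1]), e1, c1]
    exact mul_ne_zero (pow_ne_zero _ hA₂) hgc
  have nA : A.det ≠ 0 := by
    apply ne_zero_of_eval (t := 0)
    rw [hdetA, e0]
    exact hA₁
  obtain ⟨t, ht⟩ := exists_eval_ne (mul_ne_zero (mul_ne_zero nF nG) nA)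
  rw [Polynomial.eval_mul, Polynomial.eval_mul, mul_ne_zero_iff, mul_ne_zero_iff, hdetA] at ht
  obtain ⟨⟨tF, tG⟩, tA⟩ := ht
  rw [hF' t tA] at tF
  rw [hG' t tA] at tG
  refine ⟨toF (cell t), toF_mem.2 (cell_mem tA ?_ ?_), right_ne_zero_of_mul tF,
    right_ne_zero_of_mul tG⟩
  · simp [b', hB₁, hB₂]
  · simp [c', hC₁, hC₂]

lemma irr_fin {D : ℕ} {d : ℕ} (k : ℕ) (f : Fin k → Matrix (Fin (2 * D)) (Fin (2 * D)) ℝ → ℝ)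
    (hf : ∀ i, IsPoly (f i)) (hfa : ∀ i (c : ℝ) M, f i (c • M) = c ^ d * f i M)
    (h : ∀ i, ∃ M ∈ SpSetF D, f i M ≠ 0) : ∃ M ∈ SpSetF D, ∀ i, f i M ≠ 0 := by
  suffices H : ∀ s : Finset (Fin k), ∃ M ∈ SpSetF D, ∏ i ∈ s, f i M ≠ 0 by
    obtain ⟨M, hM, hp⟩ := H Finset.univ
    exact ⟨M, hM, fun i => Finset.prod_ne_zero_iff.1 hp i (Finset.mem_univ i)⟩
  intro s
  induction s using Finset.induction_on with
  | empty => exact ⟨1, Sp_one D, by simp⟩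
  | insert a s ha ih =>
    obtain ⟨M₂, hM₂, h2⟩ := ih
    obtain ⟨M₁, hM₁, h1⟩ := h a
    obtain ⟨M, hM, h3, h4⟩ := irr_two (f := f a) (g := fun M => ∏ i ∈ s, f i M) (hf a)
      (IsPoly.prod s fun i _ => hf i) (a := d) (b := d * s.card) (hfa a) (by
        intro c M
        simp only [hfa, Finset.prod_mul_distrib, Finset.prod_const]
        rw [pow_mul]) hM₁ hM₂ h1 h2
    refine ⟨M, hM, ?_⟩
    rw [Finset.prod_insert ha]
    exact mul_ne_zero h3 h4

end GM

namespace GM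

variable {D p : ℕ}

lemma mem_Lp_gen (h : p ≤ 2 * D) {M : Matrix (Fin (2 * D)) (Fin (2 * D)) ℝ} (hM : M ∈ SpSetF D) :
    (fun s => compound (2 * D) p M s (basSubset (2 * D) p h)) ∈ Lp D p h :=
  Submodule.subset_span ⟨M, hM, rfl⟩

lemma mulVec_single' {ι : Type*} [Fintype ι] [DecidableEq ι] (A : Matrix ι ι ℝ) (b : ι) :
    A *ᵥ (Pi.single b 1) = fun s => A s b := by
  ext s
  simp

lemma Lp_invariant (h : p ≤ 2 * D) {M : Matrix (Fin (2 * D)) (Fin (2 * D)) ℝ}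
    (hM : M ∈ SpSetF D) {x : SubIdx (2 * D) p → ℝ} (hx : x ∈ Lp D p h) :
    compound (2 * D) p M *ᵥ x ∈ Lp D p h := by
  have : Lp D p h ≤ (Lp D p h).comap (Matrix.mulVecLin (compound (2 * D) p M)) := by
    refine Submodule.span_le.2 ?_
    rintro v ⟨K, hK, rfl⟩
    show compound (2 * D) p M *ᵥ _ ∈ Lp D p h
    rw [← mulVec_single', Matrix.mulVec_mulVec, ← compound_mul, mulVec_single']
    exact mem_Lp_gen h (Sp_mul hM hK)
  exact this hx

/-- A nonzero vector of `L_p` is detected by the top coordinate of some translate. -/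
lemma Lp_detect (h : p ≤ 2 * D) {v : SubIdx (2 * D) p → ℝ} (hv : v ∈ Lp D p h) (hv0 : v ≠ 0) :
    ∃ M ∈ SpSetF D, (compound (2 * D) p M *ᵥ v) (basSubset (2 * D) p h) ≠ 0 := by
  by_contra hcon
  push Not at hcon
  have hz : ∀ w ∈ Lp D p h, w ⬝ᵥ v = 0 := by
    intro w hw
    refine Submodule.span_induction (p := fun w _ => w ⬝ᵥ v = 0) ?_ ?_ ?_ ?_ hw
    · rintro w ⟨M, hM, rfl⟩
      have := hcon Mᵀ (Sp_transpose hM)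
      rw [compound_transpose] at this
      exact this
    · simp
    · intro x y _ _ hx hy
      rw [add_dotProduct, hx, hy, add_zero]
    · intro c x _ hx
      rw [smul_dotProduct, hx, smul_zero]
  exact hv0 (dotProduct_self_eq_zero.1 (hz v hv))

/-- the contracting diagonal element -/
noncomputable def dg (D p : ℕ) (t : ℝ) : Matrix (Fin (2 * D)) (Fin (2 * D)) ℝ :=
  toF (Matrix.fromBlocks (Matrix.diagonal fun i : Fin D => if (i : ℕ) < p then t else 1) 0 0
    (Matrix.diagonal fun i : Fin D => if (i : ℕ) < p then t⁻¹ else 1))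

lemma dg_mem {t : ℝ} (ht : t ≠ 0) : dg D p t ∈ SpSetF D := by
  rw [dg, toF_mem]
  apply diag_mem
  rw [Matrix.diagonal_transpose, Matrix.diagonal_mul_diagonal, ← Matrix.diagonal_one]
  congr 1
  ext i
  split_ifs <;> simp [ht]

noncomputable def dgv (D p : ℕ) (t : ℝ) (x : Fin (2 * D)) : ℝ :=
  Sum.elim (fun i : Fin D => if (i : ℕ) < p then t else 1)
      (fun i : Fin D => if (i : ℕ) < p then t⁻¹ else 1) ((eqv D).symm x)

lemma dg_eq (t : ℝ) : dg D p t = Matrix.diagonal (dgv D p t) := by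
  rw [dg, Matrix.fromBlocks_diagonal, toF, Matrix.submatrix_diagonal_equiv]
  rfl

lemma dgv_lt (hp : p ≤ D) (t : ℝ) {x : Fin (2 * D)} (hx : (x : ℕ) < p) : dgv D p t x = t := by
  obtain ⟨y, rfl⟩ := (eqv D).surjective x
  rcases y with y | y
  · rw [eqv_inl] at hx
    simp [dgv, hx]
  · rw [eqv_inr] at hx
    omega

lemma dgv_ge {t : ℝ} (ht : 1 ≤ t) {x : Fin (2 * D)} (hx : ¬ (x : ℕ) < p) :
    dgv D p t x ≤ 1 := by
  obtain ⟨y, rfl⟩ := (eqv D).surjective x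
  rcases y with y | y
  · rw [eqv_inl] at hx
    simp [dgv, hx]
  · simp only [dgv, Equiv.symm_apply_apply, Sum.elim_inr]
    split_ifs
    · exact inv_le_one_of_one_le₀ ht
    · exact le_rfl

lemma dgv_pos {t : ℝ} (ht : 1 ≤ t) (x : Fin (2 * D)) : 0 < dgv D p t x := by
  have h0 : 0 < t := by linarith
  obtain ⟨y, rfl⟩ := (eqv D).surjective x
  rcases y with y | y <;> simp only [dgv, Equiv.symm_apply_apply, Sum.elim_inl, Sum.elim_inr] <;>
    split_ifs <;> positivity

/-- The basic contraction in `Sp`. -/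
lemma contraction (hpD : p ≤ D) (h : p ≤ 2 * D) :
    ∃ (d : ℕ → Matrix (Fin (2 * D)) (Fin (2 * D)) ℝ) (c : ℕ → ℝ), (∀ n, d n ∈ SpSetF D) ∧
      Tendsto (fun n => c n • compound (2 * D) p (d n)) atTop
        (𝓝 (Matrix.single (basSubset (2 * D) p h) (basSubset (2 * D) p h) 1)) := by
  refine ⟨fun n => dg D p (n + 1), fun n => (((n : ℝ) + 1) ^ p)⁻¹,
    fun n => dg_mem (by positivity), ?_⟩
  refine tendsto_pi_nhds.2 fun s => tendsto_pi_nhds.2 fun t => ?_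
  simp only [dg_eq, compound_diagonal, Matrix.smul_apply, Matrix.diagonal_apply, smul_eq_mul]
  by_cases hst : s = t
  swap
  · have : ¬ (basSubset (2 * D) p h = s ∧ basSubset (2 * D) p h = t) := by
      rintro ⟨h1, h2⟩; exact hst (h1.symm.trans h2)
    simp [hst, Matrix.single_apply, this]
  subst hst
  have hform : ∀ n : ℕ, ((((n : ℝ) + 1) ^ p)⁻¹ * ∏ i ∈ s.1, dgv D p ((n : ℝ) + 1) i) =
      ∏ i ∈ s.1, (dgv D p ((n : ℝ) + 1) i / ((n : ℝ) + 1)) := by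
    intro n
    rw [Finset.prod_div_distrib, Finset.prod_const, s.2, div_eq_inv_mul]
  simp only [if_true, hform]
  by_cases hs : s = basSubset (2 * D) p h
  · subst hs
    rw [Matrix.single_apply, if_pos ⟨rfl, rfl⟩]
    refine Tendsto.congr (f₁ := fun _ => 1) ?_ tendsto_const_nhds
    intro n
    symm
    apply Finset.prod_eq_one
    intro i hi
    rw [mem_basSubset] at hi
    rw [dgv_lt hpD _ hi]
    have : (n : ℝ) + 1 ≠ 0 := by positivity
    field_simp
  · rw [Matrix.single_apply, if_neg (fun hh => hs hh.1.symm)]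
    obtain ⟨x, hxs, hx⟩ : ∃ x ∈ s.1, ¬ (x : ℕ) < p := by
      by_contra hcon
      push Not at hcon
      apply hs
      apply Subtype.ext
      refine Finset.eq_of_subset_of_card_le (fun x hx => ?_) (by rw [s.2, (basSubset _ _ h).2])
      rw [mem_basSubset]
      exact hcon x hx
    refine squeeze_zero (g := fun n : ℕ => 1 / ((n : ℝ) + 1)) ?_ ?_
      tendsto_one_div_add_atTop_nhds_zero_nat
    · intro n
      refine Finset.prod_nonneg fun i _ => ?_
      have h1 : (1 : ℝ) ≤ (n : ℝ) + 1 := by simp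
      have := dgv_pos (D := D) (p := p) h1 i
      positivity
    · intro n
      have h1 : (1 : ℝ) ≤ (n : ℝ) + 1 := by simp
      have h0 : (0 : ℝ) < (n : ℝ) + 1 := by positivity
      rw [← Finset.mul_prod_erase _ _ hxs]
      have hb : ∏ i ∈ s.1.erase x, (dgv D p ((n : ℝ) + 1) i / ((n : ℝ) + 1)) ≤ 1 := by
        apply Finset.prod_le_one
        · intro i _
          have := dgv_pos (D := D) (p := p) h1 i
          positivity
        · intro i _
          rw [div_le_one h0]
          by_cases hi : (i : ℕ) < p
          · rw [dgv_lt hpD _ hi]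
          · exact (dgv_ge h1 hi).trans h1
      have hx1 : dgv D p ((n : ℝ) + 1) x / ((n : ℝ) + 1) ≤ 1 / ((n : ℝ) + 1) :=
        div_le_div_of_nonneg_right (dgv_ge h1 hx) h0.le
      have hx0 : 0 ≤ dgv D p ((n : ℝ) + 1) x / ((n : ℝ) + 1) := by
        have := dgv_pos (D := D) (p := p) h1 x
        positivity
      calc _ ≤ dgv D p ((n : ℝ) + 1) x / ((n : ℝ) + 1) * 1 :=
            mul_le_mul_of_nonneg_left hb hx0
        _ ≤ _ := by rw [mul_one]; exact hx1

/-- Irreducibility of `L_p`. -/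
lemma Lp_irr (hpD : p ≤ D) (h : p ≤ 2 * D) {v : SubIdx (2 * D) p → ℝ} (hv : v ∈ Lp D p h)
    (hv0 : v ≠ 0) (U : Submodule ℝ (SubIdx (2 * D) p → ℝ))
    (hU : ∀ M ∈ SpSetF D, compound (2 * D) p M *ᵥ v ∈ U) : Lp D p h ≤ U := by
  obtain ⟨K, hK, hKv⟩ := Lp_detect h hv hv0
  obtain ⟨d, c, hd, hlim⟩ := contraction hpD h
  refine Submodule.span_le.2 ?_
  rintro w ⟨M, hM, rfl⟩
  have hclosed : IsClosed (U : Set (SubIdx (2 * D) p → ℝ)) := U.closed_of_finiteDimensional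
  have hcont : Continuous (fun X : Matrix (SubIdx (2 * D) p) (SubIdx (2 * D) p) ℝ =>
      (compound (2 * D) p M * X * compound (2 * D) p K) *ᵥ v) := by
    fun_prop
  have hl2 := (hcont.tendsto _).comp hlim
  have hmem := hclosed.mem_of_tendsto hl2 (Eventually.of_forall fun n => by
    simp only [Function.comp_apply, Matrix.mul_smul, Matrix.smul_mul, Matrix.smul_mulVec]
    rw [← compound_mul, ← compound_mul]
    exact U.smul_mem _ (hU _ (Sp_mul (Sp_mul hM (hd n)) hK)))
  have heq : (compound (2 * D) p M * Matrix.single (basSubset (2 * D) p h)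
      (basSubset (2 * D) p h) 1 * compound (2 * D) p K) *ᵥ v =
      (compound (2 * D) p K *ᵥ v) (basSubset (2 * D) p h) •
        (fun s => compound (2 * D) p M s (basSubset (2 * D) p h)) := by
    rw [← mulVec_single', ← Matrix.mulVec_mulVec, ← Matrix.mulVec_mulVec, ← Matrix.mulVec_smul]
    congr 1
    rw [Matrix.single_mulVec]
    ext s
    simp [Pi.single_apply, Function.update_apply]
  have hmem' : (compound (2 * D) p M * Matrix.single (basSubset (2 * D) p h)
      (basSubset (2 * D) p h) 1 * compound (2 * D) p K) *ᵥ v ∈ U := hmem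
  rw [heq] at hmem'
  exact (U.smul_mem_iff hKv).1 hmem'

/-- Zariski density, in terms of polynomial functions -/
def ZDense (D : ℕ) (G : Set (Matrix (Fin (2 * D)) (Fin (2 * D)) ℝ)) : Prop :=
  ∀ f, IsPoly f → (∀ M ∈ G, f M = 0) → ∀ M ∈ SpSetF D, f M = 0

lemma strong_irr (hpD : p ≤ D) (h : p ≤ 2 * D) {G : Set (Matrix (Fin (2 * D)) (Fin (2 * D)) ℝ)}
    (hG : ZDense D G) : LpStronglyIrreducible D p h G := by
  rintro ⟨k, W, hW, hinv⟩
  obtain ⟨v, hvW, hv0⟩ := Submodule.exists_mem_ne_zero_of_ne_bot (hW 0).2.1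
  have hv : v ∈ Lp D p h := (hW 0).1 hvW
  have h1 : ∀ i, ∃ ℓ : (SubIdx (2 * D) p → ℝ) →ₗ[ℝ] ℝ, W i ≤ LinearMap.ker ℓ ∧
      ∃ M ∈ SpSetF D, ℓ (compound (2 * D) p M *ᵥ v) ≠ 0 := by
    intro i
    have : ∃ M ∈ SpSetF D, compound (2 * D) p M *ᵥ v ∉ W i := by
      by_contra hcon
      push Not at hcon
      exact (hW i).2.2 (le_antisymm (hW i).1 (Lp_irr hpD h hv hv0 (W i) hcon))
    obtain ⟨M, hM, hMv⟩ := this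
    obtain ⟨ℓ, hℓ, hk⟩ := Submodule.exists_le_ker_of_notMem hMv
    exact ⟨ℓ, hk, M, hM, hℓ⟩
  choose ℓ hker hne using h1
  have hpoly : ∀ i, IsPoly (fun M : Matrix (Fin (2 * D)) (Fin (2 * D)) ℝ =>
      ℓ i (compound (2 * D) p M *ᵥ v)) := by
    intro i
    have e : (fun M : Matrix (Fin (2 * D)) (Fin (2 * D)) ℝ => ℓ i (compound (2 * D) p M *ᵥ v)) =
        fun M => ∑ s, (∑ t, compound (2 * D) p M s t * v t) *
          ℓ i (fun j => if s = j then 1 else 0) := by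
      funext M
      rw [LinearMap.pi_apply_eq_sum_univ (ℓ i)]
      simp only [smul_eq_mul, Matrix.mulVec, dotProduct]
    rw [e]
    exact IsPoly.sum _ fun s _ => (IsPoly.sum _ fun t _ =>
      (IsPoly.compound p _ _).mul (IsPoly.const _)).mul (IsPoly.const _)
  obtain ⟨M, hM, hall⟩ := irr_fin (D := D) (d := p) (k + 1) _ hpoly (by
    intro i c M
    rw [compound_smul, Matrix.smul_mulVec, map_smul, smul_eq_mul]) hne
  have hzero := hG (fun M => ∏ i, ℓ i (compound (2 * D) p M *ᵥ v))
    (IsPoly.prod _ fun i _ => hpoly i) (by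
      intro M hM
      have : compound (2 * D) p M *ᵥ v ∈ ⋃ i, (W i : Set (SubIdx (2 * D) p → ℝ)) := by
        rw [← hinv M hM]
        exact ⟨v, Set.mem_iUnion.2 ⟨0, hvW⟩, rfl⟩
      obtain ⟨i, hi⟩ := Set.mem_iUnion.1 this
      exact Finset.prod_eq_zero (Finset.mem_univ i) (hker i hi)) M hM
  exact Finset.prod_ne_zero_iff.2 (fun i _ => hall i) hzero

end GM

namespace GM

section abstract_diag
variable {E : Type*} [NormedAddCommGroup E] [InnerProductSpace ℝ E] [FiniteDimensional ℝ E]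

lemma symp_diag (T J : E →ₗ[ℝ] E) (hT : T.IsSymmetric) (hpos : ∀ x, x ≠ 0 → 0 < inner ℝ x (T x))
    (hJJ : ∀ x, J (J x) = -x) (hJ : ∀ x y, inner ℝ (J x) y = - inner ℝ x (J y))
    (hTJ : ∀ x, T (J (T x)) = J x) :
    ∀ k : ℕ, 2 * k ≤ Module.finrank ℝ E → ∃ (v : Fin k → E) (l : Fin k → ℝ),
      (∀ i, 1 ≤ l i) ∧ (∀ i, T (v i) = l i • v i) ∧
      (∀ i j, inner ℝ (v i) (v j) = if i = j then (1 : ℝ) else 0) ∧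
      (∀ i j, inner ℝ (v i) (J (v j)) = (0 : ℝ)) := by
  have hTJ' : ∀ (x : E) (m : ℝ), m ≠ 0 → T x = m • x → T (J x) = m⁻¹ • J x := by
    intro x m hm hx
    have := hTJ x
    rw [hx, map_smul, map_smul] at this
    conv_rhs => rw [← this, smul_smul, inv_mul_cancel₀ hm, one_smul]
  intro k
  induction k with
  | zero => intro _; exact ⟨Fin.elim0, Fin.elim0, fun i => i.elim0, fun i => i.elim0,
      fun i => i.elim0, fun i => i.elim0⟩
  | succ k ih =>
    intro hk
    obtain ⟨v, l, hl, hv, hon, hiso⟩ := ih (by omega)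
    let f : Fin k ⊕ Fin k → E := Sum.elim v (fun i => J (v i))
    let W := Submodule.span ℝ (Set.range f)
    have hW : Module.finrank ℝ W ≤ 2 * k := by
      have := finrank_range_le_card (R := ℝ) f
      simp only [Set.finrank, Fintype.card_sum, Fintype.card_fin] at this
      show Module.finrank ℝ (Submodule.span ℝ (Set.range f)) ≤ _
      omega
    have hWne : Wᗮ ≠ ⊥ := by
      intro hb
      have := Submodule.finrank_add_finrank_orthogonal W
      rw [hb, finrank_bot] at this
      omega
    have memW : ∀ x, x ∈ Wᗮ ↔ ∀ i, inner ℝ (v i) x = (0 : ℝ) ∧ inner ℝ (J (v i)) x = (0 : ℝ) := by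
      intro x
      constructor
      · intro hx i
        exact ⟨(Submodule.mem_orthogonal _ _).1 hx _ (Submodule.subset_span ⟨Sum.inl i, rfl⟩),
          (Submodule.mem_orthogonal _ _).1 hx _ (Submodule.subset_span ⟨Sum.inr i, rfl⟩)⟩
      · intro hx
        rw [Submodule.mem_orthogonal]
        intro u hu
        induction hu using Submodule.span_induction with
        | mem u hu =>
          obtain ⟨i | i, rfl⟩ := hu
          · exact (hx i).1
          · exact (hx i).2
        | zero => simp
        | add a b _ _ ha hb => rw [inner_add_left, ha, hb, add_zero]
        | smul c a _ ha => rw [inner_smul_left, ha, mul_zero]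
    have hTW : ∀ x ∈ Wᗮ, T x ∈ Wᗮ := by
      intro x hx
      rw [memW] at hx ⊢
      intro i
      have l0 : l i ≠ 0 := by have := hl i; positivity
      constructor
      · rw [← hT, hv, inner_smul_left, (hx i).1, mul_zero]
      · rw [← hT, hTJ' _ _ l0 (hv i), inner_smul_left, (hx i).2, mul_zero]
    have hJW : ∀ x ∈ Wᗮ, J x ∈ Wᗮ := by
      intro x hx
      rw [memW] at hx ⊢
      intro i
      constructor
      · have := hJ (v i) x
        rw [(hx i).2] at this
        linarith
      · rw [hJ, hJJ, inner_neg_right, (hx i).1]; simp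
    have : Nontrivial Wᗮ := (Submodule.nontrivial_iff_ne_bot).2 hWne
    have hTs := hT.restrict_invariant hTW
    have hev := hTs.hasEigenvalue_iSup_of_finiteDimensional
    obtain ⟨x, hx⟩ := hev.exists_hasEigenvector
    set m : ℝ := _ with hm
    have hx0 : (x : E) ≠ 0 := fun h => hx.2 (Subtype.ext h)
    have hxm : T (x : E) = m • (x : E) := by
      have := congrArg Subtype.val hx.apply_eq_smul
      simpa using this
    clear_value m
    -- main claim
    obtain ⟨y, μ, hyW, hy0, hμ, hyμ⟩ : ∃ (y : E) (μ : ℝ), y ∈ Wᗮ ∧ y ≠ 0 ∧ 1 ≤ μ ∧ T y = μ • y := by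
      have hmp : 0 < m := by
        have := hpos x hx0
        rw [hxm, inner_smul_right] at this
        exact pos_of_mul_pos_left this real_inner_self_nonneg
      rcases le_total 1 m with h1 | h1
      · exact ⟨x, m, x.2, hx0, h1, hxm⟩
      · refine ⟨J x, m⁻¹, hJW _ x.2, ?_, (one_le_inv₀ hmp).2 h1, hTJ' _ _ hmp.ne' hxm⟩
        intro h
        have := hJJ x
        rw [h, map_zero] at this
        exact hx0 (by simpa using this.symm)
    let z := (‖y‖⁻¹ : ℝ) • y
    have hzW : z ∈ Wᗮ := Submodule.smul_mem _ _ hyW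
    have hz1 : inner ℝ z z = (1 : ℝ) := by
      have : ‖y‖ ≠ 0 := norm_ne_zero_iff.2 hy0
      rw [real_inner_self_eq_norm_sq, norm_smul, norm_inv, norm_norm, inv_mul_cancel₀ this, one_pow]
    have hzT : T z = μ • z := by
      simp only [z, map_smul, hyμ]; rw [smul_comm]
    have hzJ : inner ℝ z (J z) = (0 : ℝ) := by
      have := hJ z z
      rw [real_inner_comm] at this
      linarith
    have hz := (memW z).1 hzW
    refine ⟨Fin.snoc v z, Fin.snoc l μ, ?_, ?_, ?_, ?_⟩
    · intro i; refine Fin.lastCases ?_ (fun i => ?_) i <;> simp [hμ, hl]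
    · intro i; refine Fin.lastCases ?_ (fun i => ?_) i <;> simp [hzT, hv]
    · intro i j
      refine Fin.lastCases ?_ (fun i => ?_) i <;> refine Fin.lastCases ?_ (fun j => ?_) j
      · simp only [Fin.snoc_last, hz1, if_true]
      · simp only [Fin.snoc_last, Fin.snoc_castSucc]
        rw [real_inner_comm, (hz j).1, if_neg (Fin.castSucc_lt_last j).ne']
      · simp only [Fin.snoc_last, Fin.snoc_castSucc]
        rw [(hz i).1, if_neg (Fin.castSucc_lt_last i).ne]
      · simp [hon]
    · intro i j
      refine Fin.lastCases ?_ (fun i => ?_) i <;> refine Fin.lastCases ?_ (fun j => ?_) j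
      · simp only [Fin.snoc_last, hzJ]
      · simp only [Fin.snoc_last, Fin.snoc_castSucc]
        rw [real_inner_comm, (hz j).2]
      · simp only [Fin.snoc_last, Fin.snoc_castSucc]
        have := hJ (v i) z
        rw [(hz i).2] at this; linarith
      · simp [hiso]
end abstract_diag

section matrix_diag
variable {n : Type*} [Fintype n] [DecidableEq n]

lemma gram_apply (f : n → EuclideanSpace ℝ n) (X : Matrix n n ℝ) (a b : n) :
    ((Matrix.of fun i j => f j i)ᵀ * X * (Matrix.of fun i j => f j i)) a b =
      inner ℝ (f a) (Matrix.toEuclideanLin X (f b)) := by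
  rw [Matrix.mul_assoc]
  simp only [Matrix.mul_apply, Matrix.transpose_apply, Matrix.of_apply, PiLp.inner_apply,
    Matrix.toLpLin_apply, Matrix.mulVec, dotProduct]
  refine Finset.sum_congr rfl fun i _ => ?_
  simp [mul_comm]

lemma inner_toE (X : Matrix n n ℝ) (x y : EuclideanSpace ℝ n) :
    inner ℝ (Matrix.toEuclideanLin X x) y = inner ℝ x (Matrix.toEuclideanLin Xᵀ y) := by
  rw [← Matrix.conjTranspose_eq_transpose_of_trivial, Matrix.toEuclideanLin_conjTranspose_eq_adjoint,
    LinearMap.adjoint_inner_right]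

lemma toE_mul (X Y : Matrix n n ℝ) (x : EuclideanSpace ℝ n) :
    Matrix.toEuclideanLin X (Matrix.toEuclideanLin Y x) = Matrix.toEuclideanLin (X * Y) x := by
  simp [Matrix.toLpLin_apply]

lemma symp_orth {D : ℕ} (M : Matrix (Fin D ⊕ Fin D) (Fin D ⊕ Fin D) ℝ)
    (hM : M ∈ Matrix.symplecticGroup (Fin D) ℝ) :
    ∃ (O : Matrix (Fin D ⊕ Fin D) (Fin D ⊕ Fin D) ℝ) (l : Fin D → ℝ), (∀ i, 1 ≤ l i) ∧
      Oᵀ * O = 1 ∧ O ∈ Matrix.symplecticGroup (Fin D) ℝ ∧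
      Oᵀ * (Mᵀ * M) * O = Matrix.diagonal (Sum.elim l (fun i => (l i)⁻¹)) := by
  have hM1 := SymplecticGroup.mem_iff.1 hM
  have hM2 := SymplecticGroup.mem_iff'.1 hM
  have hdet : IsUnit M.det := SymplecticGroup.symplectic_det hM
  set J := Matrix.J (Fin D) ℝ with hJdef
  have hJJ : J * J = -1 := Matrix.J_squared _ _
  have hJt : Jᵀ = -J := Matrix.J_transpose _ _
  let T := Matrix.toEuclideanLin (Mᵀ * M)
  let JJ := Matrix.toEuclideanLin J
  have hTm : ∀ x, T x = Matrix.toEuclideanLin (Mᵀ * M) x := fun _ => rfl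
  have h1 : ∀ x, JJ (JJ x) = -x := fun x => by
    simp only [JJ, toE_mul, hJJ, map_neg]
    simp
  have h2 : ∀ x y, inner ℝ (JJ x) y = - inner ℝ x (JJ y) := fun x y => by
    simp only [JJ, inner_toE, hJt, map_neg]
    simp
  have h3 : ∀ x, T (JJ (T x)) = JJ x := fun x => by
    simp only [JJ, T, toE_mul]
    congr 2
    calc Mᵀ * M * (J * (Mᵀ * M)) = Mᵀ * (M * J * Mᵀ) * M := by simp only [Matrix.mul_assoc]
      _ = J := by rw [hM1, hM2]
  have h4 : T.IsSymmetric := fun x y => by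
    simp only [T, inner_toE, Matrix.transpose_mul, Matrix.transpose_transpose]
  have h5 : ∀ x, x ≠ 0 → 0 < inner ℝ x (T x) := fun x hx => by
    have : inner ℝ x (T x) = inner ℝ (Matrix.toEuclideanLin M x) (Matrix.toEuclideanLin M x) := by
      rw [inner_toE, toE_mul]
    rw [this, real_inner_self_pos]
    intro h0
    apply hx
    have : Matrix.toEuclideanLin M⁻¹ (Matrix.toEuclideanLin M x) = 0 := by rw [h0, map_zero]
    rw [toE_mul, Matrix.nonsing_inv_mul _ hdet] at this
    simpa using this
  obtain ⟨v, l, hl, hv, hon, hiso⟩ := symp_diag T JJ h4 h5 h1 h2 h3 D (by simp; omega)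
  have hTJ : ∀ i, T (JJ (v i)) = (l i)⁻¹ • JJ (v i) := by
    intro i
    have l0 : l i ≠ 0 := by have := hl i; positivity
    have := h3 (v i)
    rw [hv, map_smul, map_smul] at this
    conv_rhs => rw [← this, smul_smul, inv_mul_cancel₀ l0, one_smul]
  have hon' : ∀ i j, inner ℝ (JJ (v i)) (JJ (v j)) = if i = j then (1 : ℝ) else 0 := fun i j => by
    rw [h2, h1, inner_neg_right, neg_neg, hon]
  have hiso' : ∀ i j, inner ℝ (JJ (v i)) (v j) = (0 : ℝ) := fun i j => by
    rw [h2, hiso, neg_zero]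
  let f : Fin D ⊕ Fin D → EuclideanSpace ℝ (Fin D ⊕ Fin D) := Sum.elim v (fun i => JJ (v i))
  refine ⟨Matrix.of fun i j => f j i, l, hl, ?_, ?_, ?_⟩
  · rw [← Matrix.mul_one (Matrix.of fun i j => f j i)ᵀ]
    ext a b
    rw [gram_apply]
    rcases a with a | a <;> rcases b with b | b <;>
      simp [f, hon, hon', hiso, hiso', Matrix.one_apply]
  · rw [SymplecticGroup.mem_iff']
    ext a b
    rw [gram_apply]
    change inner ℝ (f a) (JJ (f b)) = _
    rcases a with a | a <;> rcases b with b | b <;>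
      simp [f, hon, hon', hiso, hiso', h1, Matrix.J, Matrix.one_apply, apply_ite Neg.neg]
  · ext a b
    rw [gram_apply]
    change inner ℝ (f a) (T (f b)) = _
    rcases a with a | a <;> rcases b with b | b <;>
      simp [f, hv, hTJ, hon, hon', hiso, hiso', inner_smul_right, Matrix.diagonal_apply] <;>
      (by_cases hab : a = b <;> simp [hab])
end matrix_diag
end GM

namespace GM

section normcmp
variable {D p : ℕ}

lemma single_mem_Lp (h : p ≤ 2 * D) (hpD : p ≤ D) (s : SubIdx (2 * D) p)
    (hs : ∀ x ∈ s.1, (x : ℕ) < D) : (Pi.single s 1 : SubIdx (2 * D) p → ℝ) ∈ Lp D p h := by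
  have hlt : ∀ j : Fin p, ((s.1.orderIsoOfFin s.2 j : Fin (2 * D)) : ℕ) < D := fun j =>
    hs _ (s.1.orderIsoOfFin s.2 j).2
  let g : Fin p ↪ Fin D := ⟨fun j => ⟨(s.1.orderIsoOfFin s.2 j : Fin (2 * D)), hlt j⟩, by
    intro a b hab
    simp only [Fin.mk.injEq] at hab
    exact (s.1.orderIsoOfFin s.2).injective (Subtype.ext (Fin.ext hab))⟩
  obtain ⟨σ, hσ⟩ : ∃ σ : Equiv.Perm (Fin D), ∀ j : Fin p, σ (Fin.castLE hpD j) = g j :=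
    Equiv.Perm.exists_extending_pair _ _ (Fin.castLE_injective hpD) g.injective
  let P : Matrix (Fin D) (Fin D) ℝ := Matrix.of fun x y => if x = σ y then 1 else 0
  have hP : Pᵀ * P = 1 := by
    ext x y
    simp [P, Matrix.mul_apply, Matrix.one_apply, eq_comm]
  have hM : toF (Matrix.fromBlocks P 0 0 P) ∈ SpSetF D := toF_mem.2 (diag_mem hP)
  have := mem_Lp_gen h hM
  convert this using 1
  ext t
  rw [compound_col (p := p) (toF (Matrix.fromBlocks P 0 0 P)) (basSubset (2 * D) p h) s
    (fun _ => 1)]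
  · simp [Pi.single_apply]
  · intro x j
    have e1 : ((basSubset (2 * D) p h).1.orderIsoOfFin (basSubset (2 * D) p h).2 j : Fin (2 * D))
        = eqv D (Sum.inl (Fin.castLE hpD j)) := by
      apply Fin.ext
      rw [basSubset_val, eqv_inl]; rfl
    have e2 : ((s.1.orderIsoOfFin s.2 j : Fin (2 * D))) = eqv D (Sum.inl (g j)) := by
      apply Fin.ext
      rw [eqv_inl]; rfl
    rw [e1, e2]
    obtain ⟨x, rfl⟩ := (eqv D).surjective x
    rcases x with x | x <;> simp [toF, P, hσ]

/-- squared Frobenius norm -/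
def fro {m n : Type*} [Fintype m] [Fintype n] (X : Matrix m n ℝ) : ℝ := ∑ i, ∑ j, X i j ^ 2

lemma fro_eq {m n : Type*} [Fintype m] [Fintype n] (X : Matrix m n ℝ) :
    fro X = (X * Xᵀ).trace := by
  simp [fro, Matrix.trace, Matrix.mul_apply, pow_two]

lemma fro_eq' {m n : Type*} [Fintype m] [Fintype n] (X : Matrix m n ℝ) :
    fro X = (Xᵀ * X).trace := by
  rw [fro_eq, Matrix.trace_mul_comm]

lemma fro_zero {m n : Type*} [Fintype m] [Fintype n] {X : Matrix m n ℝ} (h : fro X ≤ 0) : X = 0 := by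
  have h0 : fro X = 0 := le_antisymm h (by unfold fro; positivity)
  unfold fro at h0
  ext i j
  rw [Finset.sum_eq_zero_iff_of_nonneg (fun _ _ => by positivity)] at h0
  have := h0 i (Finset.mem_univ _)
  rw [Finset.sum_eq_zero_iff_of_nonneg (fun _ _ => by positivity)] at this
  simpa using this j (Finset.mem_univ _)

lemma fro_smul {m n : Type*} [Fintype m] [Fintype n] (c : ℝ) (X : Matrix m n ℝ) :
    fro (c • X) = c ^ 2 * fro X := by
  simp [fro, mul_pow, Finset.mul_sum]

lemma fro_mulVec {m n : Type*} [Fintype m] [Fintype n] (X : Matrix m n ℝ) (x : n → ℝ) :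
    ∑ i, (X *ᵥ x) i ^ 2 ≤ fro X * ∑ j, x j ^ 2 := by
  rw [fro, Finset.sum_mul]
  exact Finset.sum_le_sum fun i _ => Finset.sum_mul_sq_le_sq_mul_sq _ _ _

lemma fro_cont {m n : Type*} [Fintype m] [Fintype n] : Continuous (fro : Matrix m n ℝ → ℝ) := by
  unfold fro
  fun_prop

lemma exists_low (hpD : p ≤ D) (d : Fin (2 * D) → ℝ) (h1 : ∀ x : Fin (2 * D), (x : ℕ) < D → 1 ≤ d x)
    (h2 : ∀ x : Fin (2 * D), ¬ (x : ℕ) < D → d x ≤ 1) (h0 : ∀ x, 0 < d x) (t : SubIdx (2 * D) p) :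
    ∃ s : SubIdx (2 * D) p, (∀ x ∈ s.1, (x : ℕ) < D) ∧ ∏ i ∈ t.1, d i ≤ ∏ i ∈ s.1, d i := by
  let t1 := t.1.filter (fun x : Fin (2 * D) => (x : ℕ) < D)
  let L : Finset (Fin (2 * D)) := Finset.univ.filter (fun x : Fin (2 * D) => (x : ℕ) < D)
  have hL : L.card = D := by
    have : L = (Finset.univ : Finset (Fin D)).map (Fin.castLEEmb (by omega)) := by
      ext x
      simp only [L, Finset.mem_filter, Finset.mem_univ, true_and, Finset.mem_map]
      constructor
      · intro hx; exact ⟨⟨x, hx⟩, by ext; simp⟩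
      · rintro ⟨a, rfl⟩; simp
    rw [this]; simp
  have ht1 : t1 ⊆ L := fun x hx => by
    simp only [L, t1, Finset.mem_filter] at *
    exact ⟨Finset.mem_univ _, hx.2⟩
  have hc1 : t1.card ≤ p := (Finset.card_le_card (Finset.filter_subset _ _)).trans t.2.le
  obtain ⟨s, hs1, hs2, hs3⟩ := Finset.exists_subsuperset_card_eq ht1 hc1 (by omega)
  have hsl : ∀ x ∈ s, (x : ℕ) < D := fun x hx => (Finset.mem_filter.1 (hs2 hx)).2
  refine ⟨⟨s, hs3⟩, hsl, ?_⟩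
  rw [← Finset.prod_filter_mul_prod_filter_not t.1 (fun x : Fin (2 * D) => (x : ℕ) < D)]
  calc _ ≤ ∏ i ∈ t1, d i * 1 := by
        rw [Finset.prod_mul_distrib, Finset.prod_const_one]
        refine mul_le_mul_of_nonneg_left ?_ (Finset.prod_nonneg fun i _ => (h0 i).le)
        exact Finset.prod_le_one (fun i _ => (h0 i).le) fun i hi => h2 _ (Finset.mem_filter.1 hi).2
    _ ≤ _ := by
        simp only [mul_one]
        rw [← Finset.prod_sdiff hs1]
        refine le_mul_of_one_le_left (Finset.prod_nonneg fun i _ => (h0 i).le) ?_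
        exact Finset.one_le_prod fun i hi => h1 _ (hsl i (Finset.sdiff_subset hi))

lemma norm_cmp (hpD : p ≤ D) (h : p ≤ 2 * D)
    (E : Matrix (SubIdx (2 * D) p) (SubIdx (2 * D) p) ℝ) (hE : ∀ x ∈ Lp D p h, E *ᵥ x = x)
    (M : Matrix (Fin (2 * D)) (Fin (2 * D)) ℝ) (hM : M ∈ SpSetF D) :
    fro (compound (2 * D) p M) ≤
      Fintype.card (SubIdx (2 * D) p) * fro (compound (2 * D) p M * E) := by
  obtain ⟨M, rfl⟩ := exists_toF M
  obtain ⟨O, l, hl, hO, hOS, hd⟩ := symp_orth M (toF_mem.1 hM)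
  have hOS' := toF_mem.2 hOS
  have toF_mul : ∀ A B : Matrix (Fin D ⊕ Fin D) (Fin D ⊕ Fin D) ℝ, toF (A * B) = toF A * toF B :=
    fun A B => by simp [toF, Matrix.submatrix_mul_equiv]
  have toF_tr : ∀ A : Matrix (Fin D ⊕ Fin D) (Fin D ⊕ Fin D) ℝ, toF Aᵀ = (toF A)ᵀ :=
    fun A => rfl
  let d : Fin (2 * D) → ℝ := (Sum.elim l (fun i => (l i)⁻¹)) ∘ (eqv D).symm
  have hd' : (toF M * toF O)ᵀ * (toF M * toF O) = Matrix.diagonal d := by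
    rw [← toF_mul, ← toF_tr, ← toF_mul, Matrix.transpose_mul]
    rw [show Oᵀ * Mᵀ * (M * O) = Oᵀ * (Mᵀ * M) * O by simp only [Matrix.mul_assoc], hd]
    simp only [toF, d]
    rw [Matrix.submatrix_diagonal_equiv]
  have hO' : (toF O)ᵀ * toF O = 1 := by
    rw [← toF_tr, ← toF_mul, hO]; simp [toF]
  set A := compound (2 * D) p (toF M)
  set B := compound (2 * D) p (toF O)
  have hAB : (A * B)ᵀ * (A * B) = Matrix.diagonal fun s : SubIdx (2 * D) p => ∏ i ∈ s.1, d i := by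
    rw [← compound_diagonal, ← hd', compound_mul, compound_transpose, compound_mul]
  have hBB : Bᵀ * B = 1 := by
    rw [← compound_one, ← hO', compound_mul, compound_transpose]
  have hBB' : B * Bᵀ = 1 := mul_eq_one_comm.1 hBB
  have hfro : fro A = ∑ t : SubIdx (2 * D) p, ∏ i ∈ t.1, d i := by
    rw [fro_eq, show A * Aᵀ = (A * B) * (A * B)ᵀ by
      rw [Matrix.transpose_mul, Matrix.mul_assoc, ← Matrix.mul_assoc B, hBB', Matrix.one_mul],
      ← fro_eq, fro_eq', hAB, Matrix.trace_diagonal]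
  have hlow : ∀ s : SubIdx (2 * D) p, (∀ x ∈ s.1, (x : ℕ) < D) →
      ∏ i ∈ s.1, d i ≤ fro (A * E) := by
    intro s hs
    have hx : B *ᵥ Pi.single s 1 ∈ Lp D p h :=
      Lp_invariant h hOS' (single_mem_Lp h hpD s hs)
    have e1 : ∏ i ∈ s.1, d i = ∑ i, ((A * E) *ᵥ (B *ᵥ Pi.single s 1)) i ^ 2 := by
      rw [← Matrix.mulVec_mulVec, hE _ hx, Matrix.mulVec_mulVec, mulVec_single']
      have := congrFun (congrFun hAB s) s
      rw [Matrix.diagonal_apply_eq] at this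
      rw [← this, Matrix.mul_apply]
      simp only [Matrix.transpose_apply, pow_two]
    have e2 : ∑ i, (B *ᵥ Pi.single s 1) i ^ 2 = 1 := by
      rw [mulVec_single']
      have := congrFun (congrFun hBB s) s
      rw [Matrix.one_apply_eq] at this
      rw [← this, Matrix.mul_apply]
      simp only [Matrix.transpose_apply, pow_two]
    rw [e1]
    refine (fro_mulVec _ _).trans ?_
    rw [e2, mul_one]
  rw [hfro]
  have hdv1 : ∀ i, d (eqv D (Sum.inl i)) = l i := fun i => by simp [d]
  have hdv2 : ∀ i, d (eqv D (Sum.inr i)) = (l i)⁻¹ := fun i => by simp [d]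
  have hl0 : ∀ i, 0 < l i := fun i => lt_of_lt_of_le one_pos (hl i)
  calc _ ≤ ∑ t : SubIdx (2 * D) p, fro (A * E) := by
        refine Finset.sum_le_sum fun t _ => ?_
        have hex : ∃ s : SubIdx (2 * D) p, (∀ x ∈ s.1, (x : ℕ) < D) ∧
            ∏ i ∈ t.1, d i ≤ ∏ i ∈ s.1, d i := by
          refine exists_low hpD d ?_ ?_ ?_ t
          · intro x hx
            obtain ⟨x, rfl⟩ := (eqv D).surjective x
            rcases x with x | x
            · rw [hdv1]; exact hl x
            · rw [eqv_inr] at hx; omega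
          · intro x hx
            obtain ⟨x, rfl⟩ := (eqv D).surjective x
            rcases x with x | x
            · rw [eqv_inl] at hx; exact absurd x.2 hx
            · rw [hdv2]; exact inv_le_one_of_one_le₀ (hl x)
          · intro x
            obtain ⟨x, rfl⟩ := (eqv D).surjective x
            rcases x with x | x
            · rw [hdv1]; exact hl0 x
            · rw [hdv2]; exact inv_pos.2 (hl0 x)
        exact hex.elim fun s hs => hs.2.trans (hlow s hs.1)
    _ = _ := by simp

/-- closed cone generated by compounds -/
def Cone (D p : ℕ) (T : Set (Matrix (Fin (2 * D)) (Fin (2 * D)) ℝ)) :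
    Set (Matrix (SubIdx (2 * D) p) (SubIdx (2 * D) p) ℝ) :=
  closure {X | ∃ c : ℝ, 0 < c ∧ ∃ M ∈ T, X = c • compound (2 * D) p M}

lemma Cone_nonzero (hpD : p ≤ D) (h : p ≤ 2 * D)
    {X : Matrix (SubIdx (2 * D) p) (SubIdx (2 * D) p) ℝ} (hX : X ∈ Cone D p (SpSetF D))
    (hX0 : X ≠ 0) :
    ∃ M ∈ SpSetF D, (X * compound (2 * D) p M) *ᵥ Pi.single (basSubset (2 * D) p h) 1 ≠ 0 := by
  by_contra hcon
  push Not at hcon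
  obtain ⟨g, hg⟩ := (Lp D p h).subtype.exists_leftInverse_of_injective (Lp D p h).ker_subtype
  let E := LinearMap.toMatrix' ((Lp D p h).subtype ∘ₗ g)
  have hE1 : ∀ x, E *ᵥ x = (g x : SubIdx (2 * D) p → ℝ) := fun x => by
    rw [← Matrix.toLin'_apply, Matrix.toLin'_toMatrix']; rfl
  have hE : ∀ x ∈ Lp D p h, E *ᵥ x = x := fun x hx => by
    rw [hE1]
    exact congrArg Subtype.val (LinearMap.congr_fun hg ⟨x, hx⟩)
  have hle : fro X ≤ Fintype.card (SubIdx (2 * D) p) * fro (X * E) := by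
    refine closure_minimal (t := {X | fro X ≤ Fintype.card (SubIdx (2 * D) p) * fro (X * E)})
      ?_ ?_ hX
    · rintro _ ⟨c, hc, M, hM, rfl⟩
      have := norm_cmp hpD h E hE M hM
      simp only [Set.mem_ofPred_eq, Matrix.smul_mul, fro_smul]
      nlinarith [sq_nonneg c]
    · refine isClosed_le fro_cont (continuous_const.mul (fro_cont.comp ?_))
      fun_prop
  have hker : Lp D p h ≤ LinearMap.ker (Matrix.mulVecLin X) := by
    refine Submodule.span_le.2 ?_
    rintro w ⟨M, hM, rfl⟩
    have := hcon M hM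
    rw [← Matrix.mulVec_mulVec, mulVec_single'] at this
    exact this
  have hXE : X * E = 0 := by
    ext i j
    have : (X * E) *ᵥ Pi.single j 1 = 0 := by
      rw [← Matrix.mulVec_mulVec, hE1]
      exact hker (g _).2
    rw [mulVec_single'] at this
    exact congrFun this i
  rw [hXE] at hle
  exact hX0 (fro_zero (by simpa [fro] using hle))

lemma Cone_transpose {X : Matrix (SubIdx (2 * D) p) (SubIdx (2 * D) p) ℝ}
    (hX : X ∈ Cone D p (SpSetF D)) : Xᵀ ∈ Cone D p (SpSetF D) := by
  have hc : Continuous (fun X : Matrix (SubIdx (2 * D) p) (SubIdx (2 * D) p) ℝ => Xᵀ) := by fun_prop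
  refine map_mem_closure hc hX ?_
  rintro _ ⟨c, hc, M, hM, rfl⟩
  exact ⟨c, hc, Mᵀ, Sp_transpose hM, by rw [compound_transpose]; rfl⟩

lemma Cone_mono {S T : Set (Matrix (Fin (2 * D)) (Fin (2 * D)) ℝ)} (h : S ⊆ T) :
    Cone D p S ⊆ Cone D p T :=
  closure_mono fun _ ⟨c, hc, M, hM, e⟩ => ⟨c, hc, M, h hM, e⟩

lemma Cone_smul {T : Set (Matrix (Fin (2 * D)) (Fin (2 * D)) ℝ)}
    {X : Matrix (SubIdx (2 * D) p) (SubIdx (2 * D) p) ℝ} (hX : X ∈ Cone D p T) {c : ℝ} (hc : 0 < c) :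
    c • X ∈ Cone D p T := by
  refine map_mem_closure (continuous_const_smul c) hX ?_
  rintro _ ⟨a, ha, M, hM, rfl⟩
  exact ⟨c * a, mul_pos hc ha, M, hM, smul_smul _ _ _⟩

lemma Cone_mul {T : Set (Matrix (Fin (2 * D)) (Fin (2 * D)) ℝ)}
    (hT : ∀ A ∈ T, ∀ B ∈ T, A * B ∈ T)
    {X Y : Matrix (SubIdx (2 * D) p) (SubIdx (2 * D) p) ℝ} (hX : X ∈ Cone D p T)
    (hY : Y ∈ Cone D p T) : X * Y ∈ Cone D p T := by
  refine map_mem_closure₂ (continuous_mul) hX hY ?_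
  rintro _ ⟨a, ha, M, hM, rfl⟩ _ ⟨b, hb, K, hK, rfl⟩
  refine ⟨a * b, mul_pos ha hb, M * K, hT _ hM _ hK, ?_⟩
  rw [compound_mul, Matrix.smul_mul, Matrix.mul_smul, smul_smul]

end normcmp
end GM

namespace GM

section compactgroup
variable {n : Type*} [Fintype n] [DecidableEq n]

lemma inv_form {H : Type*} [Group H] [TopologicalSpace H] [IsTopologicalGroup H] [CompactSpace H]
    (ρ : H → Matrix n n ℝ) (hc : Continuous ρ) (hm : ∀ g h, ρ (g * h) = ρ g * ρ h)
    (h1 : ρ 1 = 1) : ∃ Q : Matrix n n ℝ, (∀ x : n → ℝ, x ≠ 0 → 0 < x ⬝ᵥ (Q *ᵥ x)) ∧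
      ∀ g, ρ g * Q * (ρ g)ᵀ = Q := by
  let _ : MeasurableSpace H := borel H
  have : BorelSpace H := ⟨rfl⟩
  let μ : MeasureTheory.Measure H := MeasureTheory.Measure.haar
  have hci : ∀ i j, Continuous fun g => ρ g i j := fun i j => hc.matrix_elem i j
  have hIntg : ∀ f : H → ℝ, Continuous f → MeasureTheory.Integrable f μ := fun f hf =>
    hf.integrable_of_hasCompactSupport (HasCompactSupport.of_compactSpace f)
  refine ⟨Matrix.of fun i j => ∫ g, (ρ g * (ρ g)ᵀ) i j ∂μ, ?_, ?_⟩
  · intro x hx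
    have e : x ⬝ᵥ ((Matrix.of fun i j => ∫ g, (ρ g * (ρ g)ᵀ) i j ∂μ) *ᵥ x) =
        ∫ g, (∑ k, (∑ i, x i * ρ g i k) ^ 2) ∂μ := by
      simp only [dotProduct, Matrix.mulVec, Matrix.of_apply]
      have e2 : ∀ g, (∑ k, (∑ i, x i * ρ g i k) ^ 2) =
          ∑ i, ∑ j, x i * x j * (ρ g * (ρ g)ᵀ) i j := by
        intro g
        simp only [Matrix.mul_apply, Matrix.transpose_apply, Finset.mul_sum, pow_two,
          Finset.sum_mul]
        rw [Finset.sum_comm]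
        refine Finset.sum_congr rfl fun i _ => ?_
        rw [Finset.sum_comm]
        refine Finset.sum_congr rfl fun j _ => Finset.sum_congr rfl fun k _ => by ring
      simp only [e2]
      rw [MeasureTheory.integral_finsetSum _ fun i _ => hIntg _ (by fun_prop)]
      refine Finset.sum_congr rfl fun i _ => ?_
      rw [MeasureTheory.integral_finsetSum _ fun j _ => hIntg _ (by fun_prop), Finset.mul_sum]
      refine Finset.sum_congr rfl fun j _ => ?_
      rw [MeasureTheory.integral_const_mul]
      ring
    rw [e]
    have hcont : Continuous fun g => (∑ k, (∑ i, x i * ρ g i k) ^ 2) := by fun_prop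
    refine hcont.integral_pos_of_hasCompactSupport_nonneg_nonzero
      (HasCompactSupport.of_compactSpace _) (fun g => by positivity) (x := 1) ?_
    rw [h1]
    intro h0
    apply hx
    rw [Finset.sum_eq_zero_iff_of_nonneg (fun _ _ => by positivity)] at h0
    ext k
    simpa [Matrix.one_apply] using h0 k (Finset.mem_univ _)
  · intro g
    ext i j
    have e : (ρ g * (Matrix.of fun i j => ∫ g, (ρ g * (ρ g)ᵀ) i j ∂μ) * (ρ g)ᵀ) i j =
        ∫ h, (ρ (g * h) * (ρ (g * h))ᵀ) i j ∂μ := by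
      have e2 : ∀ h, (ρ (g * h) * (ρ (g * h))ᵀ) i j =
          ∑ l, ∑ k, ρ g i k * ρ g j l * (ρ h * (ρ h)ᵀ) k l := by
        intro h
        rw [hm, Matrix.transpose_mul, show ρ g * ρ h * ((ρ h)ᵀ * (ρ g)ᵀ) =
          ρ g * (ρ h * (ρ h)ᵀ) * (ρ g)ᵀ by simp only [Matrix.mul_assoc]]
        rw [Matrix.mul_apply]
        refine Finset.sum_congr rfl fun l _ => ?_
        rw [Matrix.mul_apply, Finset.sum_mul]
        refine Finset.sum_congr rfl fun k _ => ?_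
        rw [Matrix.transpose_apply]; ring
      simp only [e2]
      rw [MeasureTheory.integral_finsetSum _ fun i _ => hIntg _ (by fun_prop), Matrix.mul_apply]
      refine Finset.sum_congr rfl fun l _ => ?_
      rw [MeasureTheory.integral_finsetSum _ fun j _ => hIntg _ (by fun_prop), Matrix.mul_apply,
        Finset.sum_mul]
      refine Finset.sum_congr rfl fun k _ => ?_
      rw [MeasureTheory.integral_const_mul, Matrix.transpose_apply, Matrix.of_apply]
      ring
    rw [e, MeasureTheory.integral_mul_left_eq_self (fun h => (ρ h * (ρ h)ᵀ) i j) g]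
    rfl

attribute [local instance] Matrix.normedAddCommGroup Matrix.normedSpace

lemma scale_det (X : Matrix n n ℝ) [Nonempty n] (hX : X.det ≠ 0) :
    ∃ c : ℝ, 0 < c ∧ |(c • X).det| = 1 := by
  have hd : 0 < |X.det| := abs_pos.2 hX
  refine ⟨(|X.det|⁻¹) ^ ((Fintype.card n : ℝ)⁻¹), Real.rpow_pos_of_pos (inv_pos.2 hd) _, ?_⟩
  rw [Matrix.det_smul, abs_mul, Real.rpow_inv_natCast_pow (by positivity) Fintype.card_ne_zero,
    abs_of_pos (inv_pos.2 hd), inv_mul_cancel₀ hd.ne']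

lemma compact_one (S : Set (Matrix n n ℝ)) [Nonempty n] (hcl : IsClosed S)
    (hsmul : ∀ X ∈ S, ∀ c : ℝ, 0 < c → c • X ∈ S) (hinv : ∀ X ∈ S, X ≠ 0 → X.det ≠ 0) :
    IsCompact {X | X ∈ S ∧ |X.det| = 1} := by
  have hdc : Continuous fun X : Matrix n n ℝ => |X.det| := by fun_prop
  have hclosed : IsClosed {X | X ∈ S ∧ |X.det| = 1} :=
    hcl.inter (isClosed_eq hdc continuous_const)
  have hU : IsCompact (S ∩ Metric.sphere (0 : Matrix n n ℝ) 1) :=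
    (isCompact_sphere _ _).inter_left hcl
  refine Metric.isCompact_iff_isClosed_bounded.2 ⟨hclosed, ?_⟩
  obtain ⟨δ, hδ, hδU⟩ : ∃ δ : ℝ, 0 < δ ∧ ∀ Y ∈ S ∩ Metric.sphere (0 : Matrix n n ℝ) 1,
      δ ≤ |Y.det| := by
    rcases (S ∩ Metric.sphere (0 : Matrix n n ℝ) 1).eq_empty_or_nonempty with h | h
    · exact ⟨1, one_pos, by simp [h]⟩
    · obtain ⟨Y, hY, hmin⟩ := hU.exists_isMinOn h hdc.continuousOn
      refine ⟨|Y.det|, abs_pos.2 (hinv _ hY.1 ?_), fun Z hZ => hmin hZ⟩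
      rintro rfl
      simpa using hY.2
  refine (Metric.isBounded_closedBall (x := (0 : Matrix n n ℝ)) (r := max 1 (δ⁻¹))).subset ?_
  rintro X ⟨hX, hdet⟩
  rw [mem_closedBall_zero_iff]
  rcases le_total ‖X‖ 1 with h1 | h1
  · exact le_max_of_le_left h1
  · have h0 : 0 < ‖X‖ := by linarith
    have := hδU (‖X‖⁻¹ • X) ⟨hsmul _ hX _ (inv_pos.2 h0), by
      rw [mem_sphere_zero_iff_norm, norm_smul, norm_inv, norm_norm, inv_mul_cancel₀ h0.ne']⟩
    rw [Matrix.det_smul, abs_mul, hdet, mul_one, abs_of_pos (by positivity), inv_pow] at this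
    have h2 : ‖X‖ ^ Fintype.card n ≤ δ⁻¹ := (le_inv_comm₀ hδ (by positivity)).1 this
    exact le_max_of_le_right ((le_self_pow₀ h1 Fintype.card_ne_zero).trans h2)

lemma invariant_form (S : Set (Matrix n n ℝ)) (hcl : IsClosed S)
    (hsmul : ∀ X ∈ S, ∀ c : ℝ, 0 < c → c • X ∈ S) (hmul : ∀ X ∈ S, ∀ Y ∈ S, X * Y ∈ S)
    (hinv : ∀ X ∈ S, X ≠ 0 → X.det ≠ 0) (X₀ : Matrix n n ℝ) (hX₀ : X₀ ∈ S) (hX₀0 : X₀ ≠ 0) :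
    ∃ Q : Matrix n n ℝ, (∀ x : n → ℝ, x ≠ 0 → 0 < x ⬝ᵥ (Q *ᵥ x)) ∧
      ∀ X ∈ S, ∃ c : ℝ, X * Q * Xᵀ = c • Q := by
  have : Nonempty n := by
    by_contra h
    rw [not_nonempty_iff] at h
    exact hX₀0 (Subsingleton.elim _ _)
  let S1 : Set (Matrix n n ℝ) := {X | X ∈ S ∧ |X.det| = 1}
  have hS1c : IsCompact S1 := compact_one S hcl hsmul hinv
  have hscale : ∀ X ∈ S, X ≠ 0 → ∃ c : ℝ, 0 < c ∧ c • X ∈ S1 := fun X hX h0 => by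
    obtain ⟨c, hc, hd⟩ := scale_det X (hinv X hX h0)
    exact ⟨c, hc, hsmul X hX c hc, hd⟩
  have hS1mul : ∀ X ∈ S1, ∀ Y ∈ S1, X * Y ∈ S1 := fun X hX Y hY =>
    ⟨hmul X hX.1 Y hY.1, by rw [Matrix.det_mul, abs_mul, hX.2, hY.2, mul_one]⟩
  have hS1u : ∀ X ∈ S1, IsUnit X := fun X hX => by
    rw [Matrix.isUnit_iff_isUnit_det, isUnit_iff_ne_zero]
    intro h0
    have := hX.2
    rw [h0] at this
    simp at this
  have hidem : ∀ X, IsUnit X → X * X = X → X = (1 : Matrix n n ℝ) := fun X hX h => by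
    obtain ⟨u, rfl⟩ := hX
    have := congrArg (fun Z => ((u⁻¹ : (Matrix n n ℝ)ˣ) : Matrix n n ℝ) * Z) h
    simpa [← mul_assoc] using this
  obtain ⟨c₀, hc₀, hne⟩ := hscale X₀ hX₀ hX₀0
  have hcm : ∀ r : Matrix n n ℝ, Continuous fun x => x * r := fun r => by fun_prop
  have hone : (1 : Matrix n n ℝ) ∈ S1 := by
    obtain ⟨m, hm, hmm⟩ := exists_idempotent_in_compact_subsemigroup hcm S1 ⟨_, hne⟩ hS1c hS1mul
    rwa [← hidem m (hS1u m hm) hmm]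
  have hright : ∀ X ∈ S1, ∃ Y ∈ S1, X * Y = 1 := by
    intro X hX
    have hcX : Continuous fun Y : Matrix n n ℝ => X * Y := by fun_prop
    obtain ⟨m, ⟨Y, hY, rfl⟩, hmm⟩ := exists_idempotent_in_compact_subsemigroup hcm
      ((fun Y => X * Y) '' S1) ⟨_, ⟨_, hone, rfl⟩⟩ (hS1c.image hcX) (by
        rintro _ ⟨Y, hY, rfl⟩ _ ⟨Z, hZ, rfl⟩
        exact ⟨Y * (X * Z), hS1mul _ hY _ (hS1mul _ hX _ hZ), by simp [mul_assoc]⟩)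
    exact ⟨Y, hY, hidem _ (hS1u _ (hS1mul _ hX _ hY)) hmm⟩
  have hinvmem : ∀ X ∈ S1, X⁻¹ ∈ S1 := by
    intro X hX
    obtain ⟨Y, hY, hXY⟩ := hright X hX
    rwa [Matrix.inv_eq_right_inv hXY]
  let _ : Mul S1 := ⟨fun a b => ⟨a.1 * b.1, hS1mul _ a.2 _ b.2⟩⟩
  let _ : Inv S1 := ⟨fun a => ⟨a.1⁻¹, hinvmem _ a.2⟩⟩
  let _ : One S1 := ⟨⟨1, hone⟩⟩
  have hdetu : ∀ a : S1, IsUnit a.1.det := fun a =>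
    (Matrix.isUnit_iff_isUnit_det _).1 (hS1u _ a.2)
  let _ : Group S1 := Group.ofLeftAxioms
    (fun a b c => Subtype.ext (mul_assoc a.1 b.1 c.1)) (fun a => Subtype.ext (one_mul a.1))
    (fun a => Subtype.ext (Matrix.nonsing_inv_mul a.1 (hdetu a)))
  have : ContinuousMul S1 := ⟨by
    refine Continuous.subtype_mk ?_ _
    fun_prop⟩
  have : ContinuousInv S1 := ⟨by
    refine Continuous.subtype_mk ?_ _
    simp only [Matrix.inv_def, Ring.inverse_eq_inv']
    refine Continuous.smul (Continuous.inv₀ ?_ fun a => (hdetu a).ne_zero) ?_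
    · exact continuous_subtype_val.matrix_det
    · exact continuous_subtype_val.matrix_adjugate⟩
  have : IsTopologicalGroup S1 := { }
  have : CompactSpace S1 := isCompact_iff_compactSpace.1 hS1c
  obtain ⟨Q, hQ, hQinv⟩ := inv_form (H := S1) (fun a => a.1) continuous_subtype_val
    (fun _ _ => rfl) rfl
  refine ⟨Q, hQ, fun X hX => ?_⟩
  by_cases h0 : X = 0
  · exact ⟨0, by simp [h0]⟩
  · obtain ⟨c, hc, hcX⟩ := hscale X hX h0
    refine ⟨(c * c)⁻¹, ?_⟩
    have h := hQinv ⟨c • X, hcX⟩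
    simp only [Matrix.transpose_smul, Matrix.smul_mul, Matrix.mul_smul, smul_smul] at h
    rw [eq_inv_smul_iff₀ (by positivity)]
    exact h
end compactgroup
end GM

namespace GM

section contr
variable {D p : ℕ}

lemma rank_factor {n : Type*} [Fintype n] [DecidableEq n] (X : Matrix n n ℝ) (r : ℕ)
    (hXr : X.rank = r) :
    ∃ (A : Matrix n (Fin r) ℝ) (B : Matrix (Fin r) n ℝ)
      (A' : Matrix (Fin r) n ℝ) (B' : Matrix n (Fin r) ℝ),
      X = A * B ∧ A' * A = 1 ∧ B * B' = 1 := by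
  let f := Matrix.toLin' X
  have hr : Module.finrank ℝ (LinearMap.range f) = r := hXr
  let e : LinearMap.range f ≃ₗ[ℝ] (Fin r → ℝ) :=
    LinearEquiv.ofFinrankEq _ _ (by rw [hr]; simp)
  let a : (Fin r → ℝ) →ₗ[ℝ] (n → ℝ) := (LinearMap.range f).subtype ∘ₗ e.symm.toLinearMap
  let b : (n → ℝ) →ₗ[ℝ] (Fin r → ℝ) := e.toLinearMap ∘ₗ f.rangeRestrict
  have hab : a ∘ₗ b = f := by
    ext x
    simp [a, b]
  have ha : LinearMap.ker a = ⊥ := by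
    rw [LinearMap.ker_eq_bot]
    exact Subtype.val_injective.comp e.symm.injective
  have hb : LinearMap.range b = ⊤ := by
    rw [LinearMap.range_eq_top]
    exact e.surjective.comp f.surjective_rangeRestrict
  obtain ⟨a', ha'⟩ := a.exists_leftInverse_of_injective ha
  obtain ⟨b', hb'⟩ := b.exists_rightInverse_of_surjective hb
  refine ⟨LinearMap.toMatrix' a, LinearMap.toMatrix' b, LinearMap.toMatrix' a',
    LinearMap.toMatrix' b', ?_, ?_, ?_⟩
  · rw [← LinearMap.toMatrix'_comp, hab]
    simp [f]
  · rw [← LinearMap.toMatrix'_comp, ha', LinearMap.toMatrix'_id]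
  · rw [← LinearMap.toMatrix'_comp, hb', LinearMap.toMatrix'_id]

lemma det_ne_of_rank {r : ℕ} (X : Matrix (Fin r) (Fin r) ℝ) (h : r ≤ X.rank) : X.det ≠ 0 := by
  have hs : Function.Surjective (Matrix.mulVecLin X) := by
    rw [← LinearMap.range_eq_top]
    apply Submodule.eq_top_of_finrank_eq
    refine le_antisymm (Submodule.finrank_le _) ?_
    rw [Module.finrank_fin_fun]
    exact h
  have : IsUnit X := Matrix.mulVec_surjective_iff_isUnit.1 hs
  exact ((Matrix.isUnit_iff_isUnit_det _).1 this).ne_zero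

lemma limit_rank_one (hpD : p ≤ D) (h : p ≤ 2 * D) {m k : Type*} [Fintype m] [Fintype k]
    (A : Matrix m (SubIdx (2 * D) p) ℝ) (B : Matrix (SubIdx (2 * D) p) k ℝ)
    (K : Set (Matrix m k ℝ)) (hK : IsClosed K)
    (hA : ∀ (c : ℝ), ∀ M ∈ SpSetF D, c • (A * compound (2 * D) p M * B) ∈ K)
    {M₁ M₂ : Matrix (Fin (2 * D)) (Fin (2 * D)) ℝ} (h1 : M₁ ∈ SpSetF D) (h2 : M₂ ∈ SpSetF D) :
    Matrix.vecMulVec ((A * compound (2 * D) p M₁) *ᵥ Pi.single (basSubset (2 * D) p h) 1)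
      ((Bᵀ * compound (2 * D) p M₂) *ᵥ Pi.single (basSubset (2 * D) p h) 1) ∈ K := by
  obtain ⟨d, c, hd, hlim⟩ := contraction hpD h
  have hcont : Continuous (fun X : Matrix (SubIdx (2 * D) p) (SubIdx (2 * D) p) ℝ =>
      A * compound (2 * D) p M₁ * X * ((compound (2 * D) p M₂)ᵀ * B)) := by
    fun_prop
  have hl2 := (hcont.tendsto _).comp hlim
  have hmem := hK.mem_of_tendsto hl2 (Eventually.of_forall fun n => by
    have := hA (c n) (M₁ * d n * M₂ᵀ) (Sp_mul (Sp_mul h1 (hd n)) (Sp_transpose h2))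
    rw [compound_mul, compound_mul, compound_transpose] at this
    simpa only [Function.comp_apply, Matrix.mul_smul, Matrix.smul_mul, Matrix.mul_assoc] using this)
  convert hmem using 1
  rw [show (compound (2 * D) p M₂)ᵀ * B = (Bᵀ * compound (2 * D) p M₂)ᵀ by
    rw [Matrix.transpose_mul, Matrix.transpose_transpose]]
  generalize A * compound (2 * D) p M₁ = U
  generalize Bᵀ * compound (2 * D) p M₂ = V
  ext i j
  rw [Matrix.mul_apply, Finset.sum_eq_single (basSubset (2 * D) p h)]
  · rw [Matrix.mul_single_apply_same]
    simp [Matrix.vecMulVec_apply]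
  · intro k _ hk
    rw [Matrix.mul_single_apply_of_ne _ _ _ _ _ hk, zero_mul]
  · simp

lemma card_le_one_of_form {r : ℕ} (Q : Matrix (Fin r) (Fin r) ℝ)
    (hQ : ∀ x : Fin r → ℝ, x ≠ 0 → 0 < x ⬝ᵥ (Q *ᵥ x)) (u v : Fin r → ℝ) (hu : u ≠ 0) (hv : v ≠ 0)
    (hrel : ∀ i j k l, (Matrix.vecMulVec u v * Q * (Matrix.vecMulVec u v)ᵀ) i j * Q k l =
      (Matrix.vecMulVec u v * Q * (Matrix.vecMulVec u v)ᵀ) k l * Q i j) : r ≤ 1 := by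
  have e : Matrix.vecMulVec u v * Q * (Matrix.vecMulVec u v)ᵀ =
      (v ⬝ᵥ (Q *ᵥ v)) • Matrix.vecMulVec u u := by
    ext i j
    simp only [Matrix.mul_apply, Matrix.vecMulVec_apply, Matrix.transpose_apply, Matrix.smul_apply,
      smul_eq_mul, dotProduct, Matrix.mulVec, Finset.sum_mul, Finset.mul_sum]
    rw [Finset.sum_comm]
    refine Finset.sum_congr rfl fun _ _ => Finset.sum_congr rfl fun _ _ => by ring
  have hq := hQ v hv
  rw [e] at hrel
  have hrel' : ∀ i j k l, u i * u j * Q k l = u k * u l * Q i j := by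
    intro i j k l
    have := hrel i j k l
    simp only [Matrix.smul_apply, smul_eq_mul, Matrix.vecMulVec_apply] at this
    apply mul_left_cancel₀ hq.ne'
    linarith
  by_contra hr
  obtain ⟨i, hi⟩ := Function.ne_iff.1 hu
  have hi : u i ≠ 0 := hi
  have : Nontrivial (Fin r) := Fin.nontrivial_iff_two_le.2 (by omega)
  obtain ⟨k, hk⟩ := exists_ne i
  let x : Fin r → ℝ := fun j => if j = i then u k else if j = k then - u i else 0
  have hx : x ≠ 0 := Function.ne_iff.2 ⟨k, by simp [x, hk, hi]⟩
  have hxu : ∑ j, u j * x j = 0 := by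
    have : ∀ j, u j * x j = (if j = i then u i * u k else 0) + (if j = k then - (u i * u k) else 0) := by
      intro j
      by_cases h1 : j = i
      · subst h1; simp [x, hk.symm]
      · by_cases h2 : j = k
        · subst h2; simp [x, h1]; ring
        · simp [x, h1, h2]
    simp [this, Finset.sum_add_distrib]
  have h0 : u i * u i * (x ⬝ᵥ (Q *ᵥ x)) = 0 := by
    have : u i * u i * (x ⬝ᵥ (Q *ᵥ x)) = Q i i * ((∑ j, u j * x j) * (∑ j, u j * x j)) := by
      simp only [dotProduct, Matrix.mulVec, Finset.mul_sum, Finset.sum_mul]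
      rw [Finset.sum_comm]
      refine Finset.sum_congr rfl fun a _ => Finset.sum_congr rfl fun b _ => ?_
      have := hrel' i i b a
      linear_combination x a * x b * this
    rw [this, hxu]; simp
  have := hQ x hx
  have h3 : x ⬝ᵥ (Q *ᵥ x) = 0 := by
    rcases mul_eq_zero.1 h0 with h | h
    · exact absurd h (mul_ne_zero hi hi)
    · exact h
  linarith

lemma contracting (hpD : p ≤ D) (h : p ≤ 2 * D) {G : Set (Matrix (Fin (2 * D)) (Fin (2 * D)) ℝ)}
    (hGsub : G ⊆ SpSetF D) (hone : 1 ∈ G) (hmul : ∀ A ∈ G, ∀ B ∈ G, A * B ∈ G)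
    (hG : ZDense D G) : PContracting D p G := by
  set b := basSubset (2 * D) p h with hb
  have hcl : IsClosed (Cone D p G) := isClosed_closure
  have hgen : ∀ g ∈ G, compound (2 * D) p g ∈ Cone D p G := fun g hg =>
    subset_closure ⟨1, one_pos, g, hg, by rw [one_smul]⟩
  -- an element of minimal rank
  obtain ⟨X, hX, hX0, hmin⟩ : ∃ X ∈ Cone D p G, X ≠ 0 ∧
      ∀ Y ∈ Cone D p G, Y ≠ 0 → X.rank ≤ Y.rank := by
    let s : Set (Matrix (SubIdx (2 * D) p) (SubIdx (2 * D) p) ℝ) := {X | X ∈ Cone D p G ∧ X ≠ 0}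
    have hs : s.Nonempty := ⟨1, by rw [← compound_one]; exact hgen 1 hone, by
      intro h1
      have := congrFun (congrFun h1 b) b
      simp at this⟩
    obtain ⟨X, hX, hXm⟩ := (measure (fun X : Matrix (SubIdx (2 * D) p) (SubIdx (2 * D) p) ℝ =>
      X.rank)).wf.has_min s hs
    exact ⟨X, hX.1, hX.2, fun Y hY hY0 => not_lt.1 (hXm Y ⟨hY, hY0⟩)⟩
  have hXS := Cone_mono (p := p) hGsub hX
  obtain ⟨M₁, hM₁, hu'⟩ := Cone_nonzero hpD h hXS hX0
  obtain ⟨M₂, hM₂, hv'⟩ := Cone_nonzero hpD h (Cone_transpose hXS)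
    (fun h0 => hX0 (by rw [← Matrix.transpose_transpose X, h0, Matrix.transpose_zero]))
  obtain ⟨g, hg, hgX⟩ : ∃ g ∈ G, X * compound (2 * D) p g * X ≠ 0 := by
    by_contra hcon
    push Not at hcon
    have hall : ∀ M ∈ SpSetF D, X * compound (2 * D) p M * X = 0 := by
      intro M hM
      ext i j
      exact hG _ (IsPoly.lin p X X i j) (fun g hg => by rw [hcon g hg]; rfl) M hM
    have hz := limit_rank_one hpD h X X {0} isClosed_singleton
      (fun c M hM => by rw [hall M hM, smul_zero]; rfl) hM₁ hM₂
    rw [Set.mem_singleton_iff, Matrix.vecMulVec_eq_zero] at hz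
    rcases hz with hz | hz
    · exact hu' hz
    · exact hv' hz
  obtain ⟨r, hXr⟩ : ∃ r, X.rank = r := ⟨_, rfl⟩
  obtain ⟨A, B, A', B', hAB, hA', hB'⟩ := rank_factor X r hXr
  have hback : ∀ Z : Matrix (Fin r) (Fin r) ℝ, A' * (A * Z * B) * B' = Z := fun Z => by
    rw [show A' * (A * Z * B) * B' = (A' * A) * Z * (B * B') by simp only [Matrix.mul_assoc],
      hA', hB', Matrix.one_mul, Matrix.mul_one]
  let S₀ : Set (Matrix (Fin r) (Fin r) ℝ) := (fun T => B * T * A) '' (Cone D p G)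
  let S := closure S₀
  have hSC : ∀ Z ∈ S, A * Z * B ∈ Cone D p G := by
    intro Z hZ
    have hc : Continuous fun Z : Matrix (Fin r) (Fin r) ℝ => A * Z * B := by fun_prop
    refine closure_minimal (t := (fun Z => A * Z * B) ⁻¹' (Cone D p G)) ?_ (hcl.preimage hc) hZ
    rintro _ ⟨T, hT, rfl⟩
    have : A * (B * T * A) * B = X * T * X := by
      conv_rhs => rw [hAB]
      simp only [Matrix.mul_assoc]
    simp only [Set.mem_preimage, this]
    exact Cone_mul hmul (Cone_mul hmul hX hT) hX
  have hSinv : ∀ Z ∈ S, Z ≠ 0 → Z.det ≠ 0 := by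
    intro Z hZ hZ0
    apply det_ne_of_rank
    refine hXr.symm.le.trans ?_
    have h1 := hmin _ (hSC Z hZ) (fun h0 => hZ0 (by rw [← hback Z, h0]; simp))
    exact h1.trans ((Matrix.rank_mul_le_left _ _).trans (Matrix.rank_mul_le_right _ _))
  have hSsmul : ∀ Z ∈ S, ∀ c : ℝ, 0 < c → c • Z ∈ S := by
    intro Z hZ c hc
    refine map_mem_closure (continuous_const_smul c) hZ ?_
    rintro _ ⟨T, hT, rfl⟩
    exact ⟨c • T, Cone_smul hT hc, by simp⟩
  have hSmul : ∀ Z ∈ S, ∀ Y ∈ S, Z * Y ∈ S := by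
    intro Z hZ Y hY
    refine map_mem_closure₂ continuous_mul hZ hY ?_
    rintro _ ⟨T, hT, rfl⟩ _ ⟨T', hT', rfl⟩
    refine ⟨T * X * T', Cone_mul hmul (Cone_mul hmul hT hX) hT', ?_⟩
    conv_lhs => rw [hAB]
    simp only [Matrix.mul_assoc]
  have hgS : ∀ g ∈ G, B * compound (2 * D) p g * A ∈ S := fun g hg =>
    subset_closure ⟨_, hgen g hg, rfl⟩
  obtain ⟨Q, hQ, hQS⟩ := invariant_form S isClosed_closure hSsmul hSmul hSinv
    (B * compound (2 * D) p g * A) (hgS g hg) (by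
      intro h0
      apply hgX
      have : X * compound (2 * D) p g * X = A * (B * compound (2 * D) p g * A) * B := by
        conv_lhs => rw [hAB]
        simp only [Matrix.mul_assoc]
      rw [this, h0]; simp)
  have hSp : ∀ M ∈ SpSetF D, ∀ i j k l,
      ((B * compound (2 * D) p M * A) * Q * (B * compound (2 * D) p M * A)ᵀ) i j * Q k l =
      ((B * compound (2 * D) p M * A) * Q * (B * compound (2 * D) p M * A)ᵀ) k l * Q i j := by
    intro M hM i j k l
    have hpoly : ∀ i j, IsPoly fun M : Matrix (Fin (2 * D)) (Fin (2 * D)) ℝ =>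
        ((B * compound (2 * D) p M * A) * Q * (B * compound (2 * D) p M * A)ᵀ) i j := by
      intro i j
      have : (fun M : Matrix (Fin (2 * D)) (Fin (2 * D)) ℝ =>
        ((B * compound (2 * D) p M * A) * Q * (B * compound (2 * D) p M * A)ᵀ) i j) =
        fun M => ∑ y, (∑ x, (B * compound (2 * D) p M * A) i x * Q x y) *
          (B * compound (2 * D) p M * A) j y := by
        funext M
        rw [Matrix.mul_apply]
        simp only [Matrix.transpose_apply]
        refine Finset.sum_congr rfl fun y _ => ?_
        rw [Matrix.mul_apply]
      rw [this]
      exact IsPoly.sum _ fun y _ => (IsPoly.sum _ fun x _ =>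
        (IsPoly.lin p B A i x).mul (IsPoly.const _)).mul (IsPoly.lin p B A j y)
    have := hG _ (((hpoly i j).mul (IsPoly.const (Q k l))).sub
      ((hpoly k l).mul (IsPoly.const (Q i j)))) (fun g hg => by
        obtain ⟨c, hc⟩ := hQS _ (hgS g hg)
        rw [hc]
        simp only [Matrix.smul_apply, smul_eq_mul]
        ring) M hM
    linarith
  let K : Set (Matrix (Fin r) (Fin r) ℝ) :=
    {Z | ∀ i j k l, (Z * Q * Zᵀ) i j * Q k l = (Z * Q * Zᵀ) k l * Q i j}
  have hK : IsClosed K := by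
    have : K = ⋂ i, ⋂ j, ⋂ k, ⋂ l, {Z | (Z * Q * Zᵀ) i j * Q k l = (Z * Q * Zᵀ) k l * Q i j} := by
      ext Z; simp [K]
    rw [this]
    have hc : ∀ i j, Continuous fun Z : Matrix (Fin r) (Fin r) ℝ => (Z * Q * Zᵀ) i j := by
      intro i j
      apply Continuous.matrix_elem
      fun_prop
    exact isClosed_iInter fun i => isClosed_iInter fun j => isClosed_iInter fun k =>
      isClosed_iInter fun l => isClosed_eq ((hc i j).mul continuous_const)
        ((hc k l).mul continuous_const)
  have hrel := limit_rank_one hpD h B A K hK (fun c M hM i j k l => by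
    have := hSp M hM i j k l
    simp only [Matrix.transpose_smul, Matrix.smul_mul, Matrix.mul_smul, Matrix.smul_apply,
      smul_eq_mul]
    linear_combination c * c * this) hM₁ hM₂
  have hr : X.rank ≤ 1 := by
    rw [hXr]
    refine card_le_one_of_form Q hQ _ _ ?_ ?_ hrel
    · intro h0
      apply hu'
      rw [show X * compound (2 * D) p M₁ = A * (B * compound (2 * D) p M₁) by
        conv_lhs => rw [hAB]
        rw [Matrix.mul_assoc], ← Matrix.mulVec_mulVec, h0, Matrix.mulVec_zero]
    · intro h0
      apply hv'
      rw [show Xᵀ * compound (2 * D) p M₂ = Bᵀ * (Aᵀ * compound (2 * D) p M₂) by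
        conv_lhs => rw [hAB]
        rw [Matrix.transpose_mul, Matrix.mul_assoc], ← Matrix.mulVec_mulVec, h0,
        Matrix.mulVec_zero]
  have hr1 : X.rank = 1 := by
    refine le_antisymm hr (Nat.one_le_iff_ne_zero.2 fun h0 => hX0 ?_)
    have : IsEmpty (Fin r) := by rw [← hXr, h0]; infer_instance
    rw [hAB]
    ext i j
    simp [Matrix.mul_apply]
  have hseq : ∃ Y : ℕ → (SubIdx (2 * D) p → SubIdx (2 * D) p → ℝ),
      (∀ n, ∃ c : ℝ, 0 < c ∧ ∃ M ∈ G, Y n = c • compound (2 * D) p M) ∧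
      Tendsto Y atTop (𝓝 X) :=
    mem_closure_iff_seq_limit (X := SubIdx (2 * D) p → SubIdx (2 * D) p → ℝ).1 hX
  obtain ⟨Y, hY, hlim⟩ := hseq
  choose c hc M hM hYM using hY
  refine ⟨M, c, X, hM, hc, hr1, fun s t => ?_⟩
  have := tendsto_pi_nhds.1 (tendsto_pi_nhds.1 hlim s) t
  refine this.congr fun n => ?_
  rw [hYM]
  rfl

end contr
end GM

/-- **The Goldsheid–Margulis criterion.** A Zariski-dense subgroup `G` of `Sp_D(ℝ)` is
`p`-contracting and `L_p`-strongly irreducible for every `p ∈ {1, …, D}`. -/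
theorem goldsheid_margulis_criterion (D : ℕ) (hD : 1 ≤ D)
    (G : Set (Matrix (Fin (2 * D)) (Fin (2 * D)) ℝ))
    (hGsub : G ⊆ SpSetF D)
    (hone : (1 : Matrix (Fin (2 * D)) (Fin (2 * D)) ℝ) ∈ G)
    (hmul : ∀ A ∈ G, ∀ B ∈ G, A * B ∈ G)
    (hinv : ∀ A ∈ G, A⁻¹ ∈ G)
    (hdense : ∀ P : MvPolynomial (Fin (2 * D) × Fin (2 * D)) ℝ,
      (∀ M ∈ G, MvPolynomial.eval (fun q => M q.1 q.2) P = 0) →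
      ∀ M ∈ SpSetF D, MvPolynomial.eval (fun q => M q.1 q.2) P = 0) :
    ∀ p : ℕ, 1 ≤ p → ∀ hpD : p ≤ D,
      PContracting D p G ∧
        LpStronglyIrreducible D p (le_trans hpD (by omega)) G := by
  have hG : GM.ZDense D G := by
    rintro f ⟨P, hP⟩ hf M hM
    rw [← hP]
    exact hdense P (fun K hK => by rw [hP]; exact hf K hK) M hM
  intro p hp hpD
  exact ⟨GM.contracting hpD (le_trans hpD (by omega)) hGsub hone hmul hG,
    GM.strong_irr hpD _ hG⟩
end

section
/- Let D ≥ 1 and let V₀ be the D×D real matrix with all diagonal entries 0, with entries 1 on the sub-diagonal and super-diagonal, and 0 elsewhere. For E ∈ ℝ and v = (v₁,…,v_D) ∈ {0,1}^D, let T_v(E) be the 2D×2D real block matrix [[V₀ + diag(v₁,…,v_D) − E·I_D, −I_D],[I_D, 0]]; each T_v(E) belongs to Sp_D(ℝ). Then for every E ∈ ℝ, the subgroup of Sp_D(ℝ) generated by {T_v(E) : v ∈ {0,1}^D} is Zariski-dense in Sp_D(ℝ). -/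
open scoped Matrix
/-- The standard symplectic form matrix `J = [[0, -I],[I, 0]]`. -/
def Jmat (D : ℕ) : Matrix (Fin D ⊕ Fin D) (Fin D ⊕ Fin D) ℝ :=
  Matrix.fromBlocks 0 (-1) 1 0

/-- The symplectic group `Sp_D(ℝ)`, as a set of `2D × 2D` real matrices `M` with
`Mᵀ J M = J`. -/
def SpSet (D : ℕ) : Set (Matrix (Fin D ⊕ Fin D) (Fin D ⊕ Fin D) ℝ) :=
  {M | Mᵀ * Jmat D * M = Jmat D}

/-- A set `G` of symplectic matrices is Zariski-dense in `Sp_D(ℝ)` if every real polynomial in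
the matrix entries vanishing on `G` vanishes on all of `Sp_D(ℝ)`. -/
def IsZariskiDenseSp (D : ℕ) (G : Set (Matrix (Fin D ⊕ Fin D) (Fin D ⊕ Fin D) ℝ)) : Prop :=
  ∀ P : MvPolynomial ((Fin D ⊕ Fin D) × (Fin D ⊕ Fin D)) ℝ,
    (∀ M ∈ G, MvPolynomial.eval (fun q => M q.1 q.2) P = 0) →
    ∀ M ∈ SpSet D, MvPolynomial.eval (fun q => M q.1 q.2) P = 0

/-- The subgroup (as a set of matrices) generated by a set `S` of invertible matrices:
the multiplicative closure of `S` together with its inverses. -/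
def matGenGroup {n R : Type*} [Fintype n] [DecidableEq n] [CommRing R]
    (S : Set (Matrix n n R)) : Set (Matrix n n R) :=
  {A | A ∈ Submonoid.closure (S ∪ (Inv.inv '' S))}

/-- The free interaction matrix `V₀`: zero diagonal, `1` on the sub- and super-diagonal. -/
def V0 (D : ℕ) : Matrix (Fin D) (Fin D) ℝ :=
  Matrix.of fun i j => if (i : ℕ) + 1 = (j : ℕ) ∨ (j : ℕ) + 1 = (i : ℕ) then 1 else 0

/-- Transfer matrix of the discrete quasi-one-dimensional Anderson–Bernoulli model:
`T_v(E) = [[V₀ + diag v − E·I, −I],[I, 0]]`. -/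
def transferQ1D (D : ℕ) (E : ℝ) (v : Fin D → ℝ) :
    Matrix (Fin D ⊕ Fin D) (Fin D ⊕ Fin D) ℝ :=
  Matrix.fromBlocks (V0 D + Matrix.diagonal v - E • 1) (-1) 1 0


namespace TGZ

open Matrix

/-- Zariski closure of a set of matrices. -/
def zcl {n : Type*} (G : Set (Matrix n n ℝ)) : Set (Matrix n n ℝ) :=
  {M | ∀ P : MvPolynomial (n × n) ℝ,
    (∀ g ∈ G, MvPolynomial.eval (fun q => g q.1 q.2) P = 0) →
      MvPolynomial.eval (fun q => M q.1 q.2) P = 0}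

section closure
variable {n : Type*} [Fintype n] [DecidableEq n]

lemma eval_left (g M : Matrix n n ℝ) (P : MvPolynomial (n × n) ℝ) :
    MvPolynomial.eval (fun q => M q.1 q.2)
      (MvPolynomial.bind₁ (fun q : n × n => ∑ k, MvPolynomial.C (g q.1 k) *
        (MvPolynomial.X (k, q.2) : MvPolynomial (n × n) ℝ)) P)
      = MvPolynomial.eval (fun q => (g * M) q.1 q.2) P := by
  rw [MvPolynomial.eval, MvPolynomial.eval₂Hom_bind₁]
  congr 2
  ext q
  simp [Matrix.mul_apply]

lemma eval_right (g M : Matrix n n ℝ) (P : MvPolynomial (n × n) ℝ) :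
    MvPolynomial.eval (fun q => M q.1 q.2)
      (MvPolynomial.bind₁ (fun q : n × n => ∑ k,
        (MvPolynomial.X (q.1, k) : MvPolynomial (n × n) ℝ) * MvPolynomial.C (g k q.2)) P)
      = MvPolynomial.eval (fun q => (M * g) q.1 q.2) P := by
  rw [MvPolynomial.eval, MvPolynomial.eval₂Hom_bind₁]
  congr 2
  ext q
  simp [Matrix.mul_apply]

/-- The Zariski closure of a submonoid is a submonoid. -/
def H (G : Submonoid (Matrix n n ℝ)) : Submonoid (Matrix n n ℝ) where
  carrier := zcl (G : Set (Matrix n n ℝ))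
  one_mem' := fun P hP => hP 1 G.one_mem
  mul_mem' := by
    intro M N hM hN P hP
    rw [← eval_right]
    apply hM
    intro g hg
    rw [eval_right, ← eval_left]
    apply hN
    intro g' hg'
    rw [eval_left]
    exact hP _ (G.mul_mem hg hg')

lemma le_H (G : Submonoid (Matrix n n ℝ)) {g : Matrix n n ℝ} (hg : g ∈ G) : g ∈ H G :=
  fun _ hP => hP g hg

lemma one_param (G : Submonoid (Matrix n n ℝ)) (N : Matrix n n ℝ) (hN : N * N = 0)
    (h : 1 + N ∈ H G) (t : ℝ) : 1 + t • N ∈ H G := by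
  have hpow : ∀ k : ℕ, (1 + N) ^ k = 1 + (k : ℝ) • N := by
    intro k
    induction k with
    | zero => simp
    | succ k ih =>
      rw [pow_succ, ih]
      simp only [mul_add, add_mul, hN, smul_mul_assoc, one_mul, mul_one, smul_zero]
      push_cast
      rw [add_smul, one_smul]
      abel
  intro P hP
  set p : Polynomial ℝ := MvPolynomial.aeval
    (fun q : n × n => Polynomial.C ((1 : Matrix n n ℝ) q.1 q.2)
      + Polynomial.X * Polynomial.C (N q.1 q.2)) P with hp
  have hev : ∀ x : ℝ, p.eval x = MvPolynomial.eval (fun q => (1 + x • N) q.1 q.2) P := by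
    intro x
    rw [hp, ← Polynomial.coe_evalRingHom, MvPolynomial.aeval_def, MvPolynomial.hom_eval₂]
    rw [MvPolynomial.eval, MvPolynomial.coe_eval₂Hom]
    congr 1
    · ext; simp
    · ext q; simp; exact mul_comm _ _
  have hp0 : p = 0 := by
    apply Polynomial.eq_zero_of_infinite_isRoot
    apply Set.Infinite.mono (s := Set.range (fun k : ℕ => (k : ℝ)))
    · rintro _ ⟨k, rfl⟩
      show p.eval (k : ℝ) = 0
      rw [hev, ← hpow]
      exact (H G).pow_mem h k P hP
    · exact Set.infinite_range_of_injective Nat.cast_injective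
  rw [← hev, hp0, Polynomial.eval_zero]

end closure

section blocks
variable {m : Type*} [Fintype m] [DecidableEq m]

/-- upper unipotent -/
def U (S : Matrix m m ℝ) : Matrix (m ⊕ m) (m ⊕ m) ℝ := fromBlocks 1 S 0 1
/-- lower unipotent -/
def L (S : Matrix m m ℝ) : Matrix (m ⊕ m) (m ⊕ m) ℝ := fromBlocks 1 0 S 1

lemma U_mul (S T : Matrix m m ℝ) : U S * U T = U (S + T) := by
  simp [U, fromBlocks_multiply, add_comm]

lemma U_smul (G : Submonoid (Matrix (m ⊕ m) (m ⊕ m) ℝ)) {S : Matrix m m ℝ} (h : U S ∈ H G)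
    (t : ℝ) : U (t • S) ∈ H G := by
  have e : ∀ T : Matrix m m ℝ, U T = 1 + fromBlocks 0 T 0 0 := by
    intro T
    rw [← fromBlocks_one, fromBlocks_add]; simp [U]
  have := one_param G (fromBlocks 0 S 0 0) (by simp [fromBlocks_multiply]) (by rw [← e]; exact h) t
  rw [e]
  simpa [fromBlocks_smul] using this

lemma L_smul (G : Submonoid (Matrix (m ⊕ m) (m ⊕ m) ℝ)) {S : Matrix m m ℝ} (h : L S ∈ H G)
    (t : ℝ) : L (t • S) ∈ H G := by
  have e : ∀ T : Matrix m m ℝ, L T = 1 + fromBlocks 0 0 T 0 := by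
    intro T
    rw [← fromBlocks_one, fromBlocks_add]; simp [L]
  have := one_param G (fromBlocks 0 0 S 0) (by simp [fromBlocks_multiply]) (by rw [← e]; exact h) t
  rw [e]
  simpa [fromBlocks_smul] using this

/-- the matrices `S` with `U S` in the closure -/
def US (G : Submonoid (Matrix (m ⊕ m) (m ⊕ m) ℝ)) : Submodule ℝ (Matrix m m ℝ) where
  carrier := {S | U S ∈ H G}
  zero_mem' := by
    have : U (0 : Matrix m m ℝ) = 1 := by simp [U]
    simp [this]
  add_mem' := by
    intro S T hS hT
    show U (S + T) ∈ H G
    rw [← U_mul]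
    exact (H G).mul_mem hS hT
  smul_mem' := fun t S hS => U_smul G hS t

lemma W_eq (S S' : Matrix m m ℝ) (h : S * S' = 1) :
    U S * L (-S') * U S = fromBlocks 0 S (-S') 0 := by
  have h' : S' * S = 1 := mul_eq_one_comm.mp h
  simp [U, L, fromBlocks_multiply, h, h']

lemma J_mem (G : Submonoid (Matrix (m ⊕ m) (m ⊕ m) ℝ)) (hU : U (1 : Matrix m m ℝ) ∈ H G)
    (hL : L (1 : Matrix m m ℝ) ∈ H G) :
    (fromBlocks 0 (-1) 1 0 : Matrix (m ⊕ m) (m ⊕ m) ℝ) ∈ H G ∧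
    (fromBlocks 0 1 (-1) 0 : Matrix (m ⊕ m) (m ⊕ m) ℝ) ∈ H G := by
  have hU' := U_smul G hU (-1)
  have hL' := L_smul G hL (-1)
  simp only [neg_smul, one_smul] at hU' hL'
  constructor
  · have := W_eq (-1 : Matrix m m ℝ) (-1) (by simp)
    rw [neg_neg] at this
    rw [← this]
    exact mul_mem (mul_mem hU' hL) hU'
  · have := W_eq (1 : Matrix m m ℝ) 1 (by simp)
    rw [← this]
    exact mul_mem (mul_mem hU hL') hU

variable {G : Submonoid (Matrix (m ⊕ m) (m ⊕ m) ℝ)}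

lemma L_mem (hU : U (1 : Matrix m m ℝ) ∈ H G)
    (hL : L (1 : Matrix m m ℝ) ∈ H G) {S : Matrix m m ℝ} (h : S ∈ US G) : L S ∈ H G := by
  obtain ⟨h1, h2⟩ := J_mem G hU hL
  have h3 : U (-S) ∈ H G := (US G).neg_mem h
  have := mul_mem (mul_mem h1 h3) h2
  convert this using 1
  simp [U, L, fromBlocks_multiply]

lemma m_mem (hU : U (1 : Matrix m m ℝ) ∈ H G)
    (hL : L (1 : Matrix m m ℝ) ∈ H G) {S S' : Matrix m m ℝ} (h : S ∈ US G) (h' : S' ∈ US G)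
    (hS : S * S' = 1) : fromBlocks S 0 0 S' ∈ H G := by
  obtain ⟨h1, h2⟩ := J_mem G hU hL
  have hS1 : U S ∈ H G := h
  have h3 : L (-S') ∈ H G := L_mem hU hL ((US G).neg_mem h')
  have := mul_mem (mul_mem (mul_mem hS1 h3) hS1) h1
  rw [W_eq _ _ hS] at this
  convert this using 1
  simp [fromBlocks_multiply]

lemma conj_mem (hU : U (1 : Matrix m m ℝ) ∈ H G)
    (hL : L (1 : Matrix m m ℝ) ∈ H G) {S T : Matrix m m ℝ} (h : S ∈ US G) (hS : S * S = 1)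
    (hT : T ∈ US G) : S * T * S ∈ US G := by
  have h1 := m_mem hU hL h h hS
  have hT1 : U T ∈ H G := hT
  have := mul_mem (mul_mem h1 hT1) h1
  show U _ ∈ H G
  convert this using 1
  simp [U, fromBlocks_multiply, hS]

end blocks

section sym
variable {D : ℕ}

/-- elementary symmetric matrix -/
def F (i j : Fin D) : Matrix (Fin D) (Fin D) ℝ := single i j 1 + single j i 1

lemma F_adj (X : Submodule ℝ (Matrix (Fin D) (Fin D) ℝ))
    (hdiag : ∀ d, diagonal d ∈ X) (hV : V0 D ∈ X)
    (hconj : ∀ S T, S ∈ X → S * S = 1 → T ∈ X → S * T * S ∈ X)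
    (i j : Fin D) (hij : (i : ℕ) + 1 = j) : F i j ∈ X := by
  set s : Fin D → ℝ := fun k => if k ≤ i then -1 else 1 with hs
  have h1 := hconj (diagonal s) (V0 D) (hdiag s)
    (by
      rw [diagonal_mul_diagonal, ← diagonal_one]
      congr 1; ext k; simp only [hs]; split_ifs <;> simp) hV
  have h2 := X.smul_mem (1/2 : ℝ) (X.sub_mem hV h1)
  convert h2 using 1
  ext a b
  simp only [F, hs, V0, Matrix.add_apply, Matrix.single_apply, Matrix.smul_apply,
    Matrix.sub_apply, Matrix.of_apply, Matrix.mul_diagonal, Matrix.diagonal_mul, smul_eq_mul,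
    Fin.le_def, Fin.ext_iff]
  split_ifs <;> first | omega | norm_num

lemma perm_eq (c j : Fin D) (hcj : c ≠ j) : (Equiv.swap c j).permMatrix ℝ
    = F c j + diagonal (fun a => if a = c ∨ a = j then 0 else 1) := by
  ext a b
  simp only [Equiv.Perm.permMatrix, PEquiv.toMatrix_apply, Equiv.toPEquiv_apply,
    Option.mem_def, Option.some.injEq, F, Matrix.add_apply, Matrix.single_apply,
    Matrix.diagonal_apply]
  by_cases h1 : a = c
  · subst h1
    simp [hcj.symm]
  · by_cases h2 : a = j
    · subst h2
      simp [hcj]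
    · rw [Equiv.swap_apply_of_ne_of_ne h1 h2]
      simp [h1, h2, Ne.symm h1, Ne.symm h2]

lemma F_mem (X : Submodule ℝ (Matrix (Fin D) (Fin D) ℝ))
    (hdiag : ∀ d, diagonal d ∈ X) (hV : V0 D ∈ X)
    (hconj : ∀ S T, S ∈ X → S * S = 1 → T ∈ X → S * T * S ∈ X)
    (k : ℕ) : ∀ (i j : Fin D), (i : ℕ) + 1 + k = j → F i j ∈ X := by
  induction k with
  | zero => intro i j h; exact F_adj X hdiag hV hconj i j (by simpa using h)
  | succ k ih =>
    intro i j h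
    let c : Fin D := ⟨i + 1 + k, by omega⟩
    have hc : (c : ℕ) = i + 1 + k := rfl
    have hF := ih i c rfl
    set P : Matrix (Fin D) (Fin D) ℝ := (Equiv.swap c j).permMatrix ℝ with hP
    have hcj : c ≠ j := by intro e; rw [Fin.ext_iff] at e; omega
    have hic : i ≠ c := by intro e; rw [Fin.ext_iff] at e; omega
    have hij : i ≠ j := by intro e; rw [Fin.ext_iff] at e; omega
    have hPX : P ∈ X := by
      have := X.add_mem (F_adj X hdiag hV hconj c j (by omega))
        (hdiag (fun a => if a = c ∨ a = j then 0 else 1))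
      convert this using 1
      exact perm_eq c j hcj
    have hPP : P * P = 1 := by
      rw [hP, Equiv.Perm.permMatrix, ← Matrix.permMatrix_mul]
      simp
    have := hconj P (F i c) hPX hPP hF
    convert this using 1
    have e : P * F i c * P = (F i c).submatrix (Equiv.swap c j) (Equiv.swap c j) := by
      rw [hP, Equiv.Perm.permMatrix, PEquiv.toMatrix_toPEquiv_mul, PEquiv.mul_toMatrix_toPEquiv]
      simp
    rw [e]
    have hci : Equiv.swap c j i = i := Equiv.swap_apply_of_ne_of_ne hic hij
    simp only [F, Matrix.submatrix_add, Pi.add_apply, Matrix.submatrix_single_equiv,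
      Equiv.symm_swap, hci, Equiv.swap_apply_left]

lemma sym_mem (X : Submodule ℝ (Matrix (Fin D) (Fin D) ℝ))
    (hdiag : ∀ d, diagonal d ∈ X) (hV : V0 D ∈ X)
    (hconj : ∀ S T, S ∈ X → S * S = 1 → T ∈ X → S * T * S ∈ X)
    (S : Matrix (Fin D) (Fin D) ℝ) (hS : Sᵀ = S) : S ∈ X := by
  have hF : ∀ i j : Fin D, F i j ∈ X := by
    intro i j
    rcases lt_trichotomy (i : ℕ) j with h | h | h
    · exact F_mem X hdiag hV hconj (j - i - 1) i j (by omega)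
    · have : i = j := Fin.ext h
      subst this
      have e : F i i = diagonal (Pi.single i 2) := by
        rw [diagonal_single, F, ← Matrix.single_add]; norm_num
      rw [e]; exact hdiag _
    · have : F i j = F j i := by simp [F, add_comm]
      rw [this]
      exact F_mem X hdiag hV hconj (i - j - 1) j i (by omega)
  have e : S = (1/2 : ℝ) • ∑ i, ∑ j, S i j • F i j := by
    have h1 : ∑ i, ∑ j, S i j • F i j = S + Sᵀ := by
      conv_rhs => rw [matrix_eq_sum_single S]
      simp only [F, smul_add, Matrix.smul_single, smul_eq_mul, mul_one, Finset.sum_add_distrib,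
        Matrix.transpose_sum, Matrix.transpose_single]
    rw [h1, hS, ← two_smul ℝ S, smul_smul]; norm_num
  rw [e]
  exact X.smul_mem _ (X.sum_mem fun i _ => X.sum_mem fun j _ => X.smul_mem _ (hF i j))

end sym

section gen
variable {m : Type*} [Fintype m] [DecidableEq m]
variable {G : Submonoid (Matrix (m ⊕ m) (m ⊕ m) ℝ)}

lemma levi_sym (hall : ∀ S : Matrix m m ℝ, Sᵀ = S → S ∈ US G)
    (hL : L (1 : Matrix m m ℝ) ∈ H G) (S : Matrix m m ℝ) (hS : Sᵀ = S) (hd : S.det ≠ 0) :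
    fromBlocks S 0 0 (Sᵀ)⁻¹ ∈ H G := by
  rw [hS]
  exact m_mem (hall 1 (by simp)) hL (hall _ hS)
    (hall _ (by rw [Matrix.transpose_nonsing_inv, hS]))
    (Matrix.mul_nonsing_inv _ (isUnit_iff_ne_zero.mpr hd))

lemma levi_mul (A B : Matrix m m ℝ) (hA : fromBlocks A 0 0 (Aᵀ)⁻¹ ∈ H G)
    (hB : fromBlocks B 0 0 (Bᵀ)⁻¹ ∈ H G) : fromBlocks (A * B) 0 0 ((A * B)ᵀ)⁻¹ ∈ H G := by
  have := mul_mem hA hB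
  convert this using 1
  simp [fromBlocks_multiply, Matrix.mul_inv_rev]

lemma levi (hall : ∀ S : Matrix m m ℝ, Sᵀ = S → S ∈ US G)
    (hL : L (1 : Matrix m m ℝ) ∈ H G) (A : Matrix m m ℝ) (hd : A.det ≠ 0) :
    fromBlocks A 0 0 (Aᵀ)⁻¹ ∈ H G := by
  refine Matrix.diagonal_transvection_induction_of_det_ne_zero
    (fun A => fromBlocks A 0 0 (Aᵀ)⁻¹ ∈ H G) A hd ?_ ?_ ?_
  · intro d h
    exact levi_sym hall hL _ (by simp) h
  · rintro ⟨i, j, hij, c⟩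
    simp only [TransvectionStruct.toMatrix_mk]
    set P : Matrix m m ℝ := (Equiv.swap i j).permMatrix ℝ with hP
    have hPP : P * P = 1 := by
      rw [hP, Equiv.Perm.permMatrix, ← Matrix.permMatrix_mul]
      simp
    have hPt : Pᵀ = P := by
      rw [hP, Matrix.transpose_permMatrix]; simp
    have hPd : P.det ≠ 0 := by
      intro h0
      have := congrArg Matrix.det hPP
      simp [h0] at this
    have e : transvection i j c = (transvection i j c * P) * P := by
      rw [Matrix.mul_assoc, hPP, Matrix.mul_one]
    rw [e]
    apply levi_mul
    · apply levi_sym hall hL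
      · have : transvection i j c * P = P + single i i c := by
          rw [transvection, Matrix.add_mul, Matrix.one_mul, hP, Equiv.Perm.permMatrix,
            PEquiv.mul_toMatrix_toPEquiv]
          congr 1
          ext a b
          simp only [Matrix.submatrix_apply, Matrix.single_apply, Equiv.swap_apply_def,
            Equiv.symm_swap, id]
          split_ifs <;> first | (exfalso; grind) | norm_num
        rw [this]
        simp [hPt]
      · rw [Matrix.det_mul, Matrix.det_transvection_of_ne _ _ hij, one_mul]
        exact hPd
    · exact levi_sym hall hL _ hPt hPd
  · intro A B _ _ hA hB
    exact levi_mul A B hA hB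

lemma exists_shift (A C : Matrix m m ℝ) (hsym : Aᵀ * C = Cᵀ * A)
    (hinj : ∀ v : m → ℝ, A *ᵥ v = 0 → C *ᵥ v = 0 → v = 0) :
    ∃ x : ℝ, (A + x • C).det ≠ 0 := by
  by_contra! hcon
  set p : Polynomial ℝ :=
    (A.map Polynomial.C + (Polynomial.X : Polynomial ℝ) • C.map Polynomial.C).det with hp
  have hev : ∀ x : ℝ, p.eval x = (A + x • C).det := by
    intro x
    rw [hp, ← Polynomial.coe_evalRingHom, RingHom.map_det]
    congr 1
    ext i j; simp; exact mul_comm _ _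
  have hp0 : p = 0 := by
    apply Polynomial.funext
    intro x; rw [hev, hcon]; simp
  set Z : Matrix m m ℂ := A.map (algebraMap ℝ ℂ) + Complex.I • C.map (algebraMap ℝ ℂ) with hZ
  have hevI : Z.det = p.eval₂ (algebraMap ℝ ℂ) Complex.I := by
    rw [hp, ← Polynomial.coe_eval₂RingHom, RingHom.map_det]
    congr 1
    ext i j; simp [hZ]; exact mul_comm _ _
  have hZ0 : Z.det = 0 := by rw [hevI, hp0]; simp
  have hprod : (A.map (algebraMap ℝ ℂ) - Complex.I • C.map (algebraMap ℝ ℂ))ᵀ * Z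
      = (Aᵀ * A + Cᵀ * C).map (algebraMap ℝ ℂ) := by
    have h1 : (A.map (algebraMap ℝ ℂ))ᵀ * C.map (algebraMap ℝ ℂ)
        = (C.map (algebraMap ℝ ℂ))ᵀ * A.map (algebraMap ℝ ℂ) := by
      rw [← Matrix.transpose_map, ← Matrix.transpose_map, ← Matrix.map_mul, ← Matrix.map_mul, hsym]
    rw [Matrix.map_add _ (map_add _), Matrix.map_mul, Matrix.map_mul, Matrix.transpose_map,
      Matrix.transpose_map, hZ, Matrix.transpose_sub, Matrix.transpose_smul]
    simp only [Matrix.sub_mul, Matrix.mul_add, Matrix.smul_mul, Matrix.mul_smul, h1, smul_sub, smul_smul,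
      Complex.I_mul_I, neg_smul, one_smul]
    abel
  have hdet : (Aᵀ * A + Cᵀ * C).det = 0 := by
    have := congrArg Matrix.det hprod
    rw [Matrix.det_mul, hZ0, mul_zero] at this
    have h2 := RingHom.map_det (algebraMap ℝ ℂ) (Aᵀ * A + Cᵀ * C)
    rw [RingHom.mapMatrix_apply, ← this] at h2
    simpa using h2
  obtain ⟨v, hv, hv0⟩ := Matrix.exists_mulVec_eq_zero_iff.mpr hdet
  apply hv
  have h3 : (A *ᵥ v) ⬝ᵥ (A *ᵥ v) + (C *ᵥ v) ⬝ᵥ (C *ᵥ v) = 0 := by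
    have := congrArg (fun w => v ⬝ᵥ w) hv0
    simp only [Matrix.add_mulVec, dotProduct_add, dotProduct_zero, ← Matrix.mulVec_mulVec] at this
    rw [Matrix.dotProduct_mulVec v, Matrix.dotProduct_mulVec v, Matrix.vecMul_transpose,
      Matrix.vecMul_transpose] at this
    exact this
  have nn : ∀ w : m → ℝ, 0 ≤ w ⬝ᵥ w := fun w => Finset.sum_nonneg fun i _ => mul_self_nonneg _
  have ha := nn (A *ᵥ v)
  have hc := nn (C *ᵥ v)
  exact hinj v (dotProduct_self_eq_zero.mp (by linarith)) (dotProduct_self_eq_zero.mp (by linarith))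

lemma sp_gen (hall : ∀ S : Matrix m m ℝ, Sᵀ = S → S ∈ US G)
    (hL : L (1 : Matrix m m ℝ) ∈ H G) (A B C E : Matrix m m ℝ)
    (h1 : Aᵀ * C = Cᵀ * A) (h2 : Bᵀ * E = Eᵀ * B) (h3 : Aᵀ * E - Cᵀ * B = 1) (hd : A.det ≠ 0) :
    fromBlocks A B C E ∈ H G := by
  have hu : IsUnit A.det := isUnit_iff_ne_zero.mpr hd
  have hut : IsUnit Aᵀ.det := by rwa [Matrix.det_transpose]
  have hs1 : (C * A⁻¹)ᵀ = C * A⁻¹ := by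
    have : Aᵀ * (C * A⁻¹)ᵀ = Aᵀ * (C * A⁻¹) := by
      rw [← Matrix.transpose_mul, Matrix.mul_assoc, Matrix.nonsing_inv_mul _ hu, Matrix.mul_one,
        ← Matrix.mul_assoc, h1, Matrix.mul_assoc, Matrix.mul_nonsing_inv _ hu, Matrix.mul_one]
    have := congrArg (fun Z => (Aᵀ)⁻¹ * Z) this
    simpa [← Matrix.mul_assoc, Matrix.nonsing_inv_mul _ hut] using this
  have hE : E = C * A⁻¹ * B + (Aᵀ)⁻¹ := by
    have e1 : Aᵀ * E = Aᵀ * (C * A⁻¹ * B + (Aᵀ)⁻¹) := by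
      rw [Matrix.mul_add, Matrix.mul_nonsing_inv _ hut, ← Matrix.mul_assoc, ← Matrix.mul_assoc, h1,
        Matrix.mul_assoc Cᵀ, Matrix.mul_nonsing_inv _ hu, Matrix.mul_one, ← h3]
      abel
    have := congrArg (fun Z => (Aᵀ)⁻¹ * Z) e1
    simpa only [← Matrix.mul_assoc, Matrix.nonsing_inv_mul _ hut, Matrix.one_mul] using this
  have hs2 : (A⁻¹ * B)ᵀ = A⁻¹ * B := by
    have e2 : Bᵀ * (C * A⁻¹ * B) + Bᵀ * (Aᵀ)⁻¹ = (C * A⁻¹ * B)ᵀ * B + A⁻¹ * B := by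
      rw [hE] at h2
      simpa [Matrix.mul_add, Matrix.add_mul, Matrix.transpose_nonsing_inv] using h2
    have e3 : (C * A⁻¹ * B)ᵀ * B = Bᵀ * (C * A⁻¹ * B) := by
      rw [Matrix.transpose_mul, hs1, Matrix.mul_assoc]
    rw [e3] at e2
    rw [Matrix.transpose_mul, Matrix.transpose_nonsing_inv]
    exact add_left_cancel e2
  have hU1 : U (1 : Matrix m m ℝ) ∈ H G := hall 1 (by simp)
  have hU2 : U (A⁻¹ * B) ∈ H G := hall _ hs2
  have := mul_mem (mul_mem (L_mem hU1 hL (hall _ hs1)) (levi hall hL A hd)) hU2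
  convert this using 1
  have q1 : A * (A⁻¹ * B) = B := by
    rw [← Matrix.mul_assoc, Matrix.mul_nonsing_inv _ hu, Matrix.one_mul]
  have q2 : C * A⁻¹ * A = C := by
    rw [Matrix.mul_assoc, Matrix.nonsing_inv_mul _ hu, Matrix.mul_one]
  simp only [U, L, fromBlocks_multiply, Matrix.one_mul, Matrix.mul_one, Matrix.mul_zero,
    Matrix.zero_mul, add_zero, zero_add, q1, q2]
  rw [← Matrix.mul_assoc, ← hE]

end gen

section main
variable {D : ℕ}

lemma mem_SpSet_iff (A B C E : Matrix (Fin D) (Fin D) ℝ) :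
    fromBlocks A B C E ∈ SpSet D ↔
      (Cᵀ * A = Aᵀ * C ∧ Cᵀ * B - Aᵀ * E = -1) ∧ Eᵀ * A - Bᵀ * C = 1 ∧ Eᵀ * B = Bᵀ * E := by
  simp only [SpSet, Jmat, Set.mem_ofPred_eq, fromBlocks_transpose, fromBlocks_multiply,
    fromBlocks_inj, Matrix.mul_zero, Matrix.mul_one, Matrix.mul_neg, zero_add, add_zero,
    Matrix.neg_mul, ← sub_eq_add_neg, sub_eq_zero, and_assoc]

lemma sp_mem {G : Submonoid (Matrix (Fin D ⊕ Fin D) (Fin D ⊕ Fin D) ℝ)}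
    (hall : ∀ S : Matrix (Fin D) (Fin D) ℝ, Sᵀ = S → S ∈ US G)
    (hL : L (1 : Matrix (Fin D) (Fin D) ℝ) ∈ H G)
    (M : Matrix (Fin D ⊕ Fin D) (Fin D ⊕ Fin D) ℝ) (hM : M ∈ SpSet D) : M ∈ H G := by
  obtain ⟨A, B, C, E, rfl⟩ : ∃ A B C E, M = fromBlocks A B C E :=
    ⟨_, _, _, _, (fromBlocks_toBlocks M).symm⟩
  obtain ⟨⟨h1, h2⟩, h3, h4⟩ := (mem_SpSet_iff _ _ _ _).mp hM
  obtain ⟨x, hx⟩ := exists_shift A C h1.symm (by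
    intro v hA hC
    have := congrArg (fun Z => Z *ᵥ v) h3
    simpa [Matrix.sub_mulVec, ← Matrix.mulVec_mulVec, hA, hC] using this.symm)
  have h2' : Aᵀ * E - Cᵀ * B = 1 := by rw [← neg_sub, h2, neg_neg]
  have key := sp_gen hall hL (A + x • C) (B + x • E) C E
    (by simp [Matrix.add_mul, Matrix.mul_add, h1])
    (by simp [Matrix.add_mul, Matrix.mul_add, h4])
    (by
      rw [← h2']
      simp [Matrix.add_mul, Matrix.mul_add]) hx
  have hu : U ((-x) • (1 : Matrix (Fin D) (Fin D) ℝ)) ∈ H G := hall _ (by simp)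
  have := mul_mem hu key
  convert this using 1
  simp [U, fromBlocks_multiply]

/-- inverse of a transfer matrix -/
def Tinv (A : Matrix (Fin D) (Fin D) ℝ) : Matrix (Fin D ⊕ Fin D) (Fin D ⊕ Fin D) ℝ :=
  fromBlocks 0 1 (-1) A

lemma inv_eq (A : Matrix (Fin D) (Fin D) ℝ) :
    (fromBlocks A (-1) 1 0 : Matrix (Fin D ⊕ Fin D) (Fin D ⊕ Fin D) ℝ)⁻¹ = Tinv A := by
  apply Matrix.inv_eq_right_inv
  simp [Tinv, fromBlocks_multiply]

lemma V0_transpose : (V0 D)ᵀ = V0 D := by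
  ext i j
  simp [V0, or_comm]

end main
end TGZ

open TGZ Matrix

/-- **Goldsheid–Margulis.** Each transfer matrix `T_v(E)`, for `v ∈ {0,1}^D`, is symplectic,
and for every energy `E` the group generated by the `T_v(E)` is Zariski-dense in `Sp_D(ℝ)`. -/
theorem transfer_group_zariski_dense (D : ℕ) (hD : 1 ≤ D) (E : ℝ) :
    (∀ v : Fin D → ℝ, (∀ i, v i = 0 ∨ v i = 1) → transferQ1D D E v ∈ SpSet D) ∧
    IsZariskiDenseSp D (matGenGroup
      {M | ∃ v : Fin D → ℝ, (∀ i, v i = 0 ∨ v i = 1) ∧ M = transferQ1D D E v}) := by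
  refine ⟨?_, ?_⟩
  · intro v _
    rw [transferQ1D, mem_SpSet_iff]
    simp [V0_transpose]
  set S : Set (Matrix (Fin D ⊕ Fin D) (Fin D ⊕ Fin D) ℝ) :=
    {M | ∃ v : Fin D → ℝ, (∀ i, v i = 0 ∨ v i = 1) ∧ M = transferQ1D D E v} with hS
  set G := Submonoid.closure (S ∪ (Inv.inv '' S)) with hG
  have hT : ∀ v : Fin D → ℝ, (∀ i, v i = 0 ∨ v i = 1) → transferQ1D D E v ∈ H G :=
    fun v hv => le_H G (Submonoid.subset_closure (Or.inl ⟨v, hv, rfl⟩))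
  have hTi : ∀ v : Fin D → ℝ, (∀ i, v i = 0 ∨ v i = 1) →
      Tinv (V0 D + Matrix.diagonal v - E • 1) ∈ H G := by
    intro v hv
    rw [← inv_eq]
    exact le_H G (Submonoid.subset_closure (Or.inr ⟨_, ⟨v, hv, rfl⟩, rfl⟩))
  have hUv : ∀ v : Fin D → ℝ, (∀ i, v i = 0 ∨ v i = 1) → U (diagonal v) ∈ H G := by
    intro v hv
    have := mul_mem (hT v hv) (hTi 0 (by simp))
    convert this using 1
    simp [U, transferQ1D, Tinv, fromBlocks_multiply]
  have hL1 : L (1 : Matrix (Fin D) (Fin D) ℝ) ∈ H G := by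
    have := mul_mem (hTi 1 (by simp)) (hT 0 (by simp))
    convert this using 1
    simp [L, transferQ1D, Tinv, fromBlocks_multiply]
  have hU1 : U (1 : Matrix (Fin D) (Fin D) ℝ) ∈ H G := by
    have := hUv 1 (by simp)
    simpa using this
  have hdiag : ∀ d : Fin D → ℝ, diagonal d ∈ US G := by
    intro d
    have e : diagonal d = ∑ i, d i • diagonal (Pi.single i (1 : ℝ)) := by
      ext a b
      simp only [Matrix.sum_apply, Matrix.smul_apply, Matrix.diagonal_apply, Pi.single_apply,
        smul_eq_mul]
      split_ifs <;> simp
    rw [e]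
    refine (US G).sum_mem fun i _ => (US G).smul_mem _ (hUv _ ?_)
    intro j
    rw [Pi.single_apply]
    split_ifs <;> simp
  have hV : V0 D ∈ US G := by
    have h0 : V0 D + Matrix.diagonal 0 - E • 1 ∈ US G := by
      have := mul_mem (hT 0 (by simp)) (J_mem G hU1 hL1).2
      show U _ ∈ H G
      convert this using 1
      simp [U, transferQ1D, fromBlocks_multiply]
    have h1 : E • (1 : Matrix (Fin D) (Fin D) ℝ) ∈ US G := (US G).smul_mem E hU1
    have := (US G).add_mem h0 h1
    simpa using this
  have hall := sym_mem (US G) hdiag hV (fun S T h1 h2 h3 => conj_mem hU1 hL1 h1 h2 h3)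
  intro P hP M hM
  exact sp_mem hall hL1 M hM P hP
end
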